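/- arXiv:2510.24187 — 5 statements merged into one kernel-verified Lean document; each statement's English description precedes it below -/
import Mathlib

section
/- Let K ⊆ ℝ^d be a convex set with nonempty interior, ϑ ≥ 0, and R a ϑ-self-concordant barrier on K. Then for all x, y ∈ int K, R(y) − R(x) ≤ −ϑ · ln(1 − π_x(y)), where π_x(y) = inf{t > 0 : x + t⁻¹(y−x) ∈ K} is the Minkowski function of K at x. -/
noncomputable section
open MeasureTheory ProbabilityTheory Real Filter Topology Matrix
open scoped RealInnerProductSpace

/-- `E d` is the Euclidean space `ℝ^d`. -/
abbrev E (d : ℕ) : Type := EuclideanSpace ℝ (Fin d)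

/-- The second directional derivative `D²R(x)[h,h]`, i.e. the Hessian quadratic form. -/
def hessQF {d : ℕ} (R : E d → ℝ) (x h : E d) : ℝ := iteratedFDeriv ℝ 2 R x ![h, h]

/-- `R` is a self-concordant function on `K`: three times continuously differentiable and
convex on `int K`, blowing up to `+∞` along sequences converging to the boundary, and with
`|D³R(x)[h,h,h]| ≤ 2 (D²R(x)[h,h])^{3/2}`. -/
def IsSelfConcordant {d : ℕ} (K : Set (E d)) (R : E d → ℝ) : Prop :=
  ContDiffOn ℝ 3 R (interior K) ∧
  ConvexOn ℝ (interior K) R ∧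
  (∀ (x : ℕ → E d) (p : E d), (∀ n, x n ∈ interior K) →
      Tendsto x atTop (𝓝 p) → p ∈ frontier K →
      Tendsto (fun n => R (x n)) atTop atTop) ∧
  (∀ x ∈ interior K, ∀ h : E d,
      |iteratedFDeriv ℝ 3 R x ![h, h, h]| ≤ 2 * (hessQF R x h) ^ (3/2 : ℝ))

/-- `R` is a `ϑ`-self-concordant barrier on `K`. -/
def IsSelfConcordantBarrier {d : ℕ} (K : Set (E d)) (ϑ : ℝ) (R : E d → ℝ) : Prop :=
  IsSelfConcordant K R ∧
  ∀ x ∈ interior K, ∀ h : E d, |fderiv ℝ R x h| ≤ Real.sqrt (ϑ * hessQF R x h)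

/-- The Minkowski function of `K` at `x`: `π_x(y) = inf {t > 0 : x + t⁻¹ (y - x) ∈ K}`. -/
def minkowskiFn {d : ℕ} (K : Set (E d)) (x y : E d) : ℝ :=
  sInf {t : ℝ | 0 < t ∧ x + t⁻¹ • (y - x) ∈ K}

/-- The derivative of `t ↦ f (x + t • h)` at a point where `f` is differentiable. -/
theorem hasDerivAt_comp_line {V F : Type*} [NormedAddCommGroup V] [NormedSpace ℝ V]
    [NormedAddCommGroup F] [NormedSpace ℝ F] {f : V → F} {x h : V} {t : ℝ}
    (hf : DifferentiableAt ℝ f (x + t • h)) :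
    HasDerivAt (fun s : ℝ => f (x + s • h)) (fderiv ℝ f (x + t • h) h) t := by
  have h1 : HasDerivAt (fun s : ℝ => x + s • h) h t := by
    simpa using ((hasDerivAt_id t).smul_const h).const_add x
  exact hf.hasFDerivAt.comp_hasDerivAt t h1

/-- The second derivative of `t ↦ R (x + t • h)` is the Hessian quadratic form. -/
theorem hasDerivAt_fderiv_line {d : ℕ} {R : E d → ℝ} {x h : E d} {t : ℝ}
    (hR : ContDiffAt ℝ 2 R (x + t • h)) :
    HasDerivAt (fun s : ℝ => fderiv ℝ R (x + s • h) h) (hessQF R (x + t • h) h) t := by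
  have h1 : DifferentiableAt ℝ (fderiv ℝ R) (x + t • h) :=
    (hR.fderiv_right (m := 1) (by norm_num)).differentiableAt (by norm_num)
  have h2 := (hasDerivAt_comp_line h1).clm_apply (hasDerivAt_const t h)
  simpa [hessQF, iteratedFDeriv_two_apply] using h2

/-- A differentiable convex function with derivative `g` has `g' ≥ 0`. -/
theorem ConvexOn.second_deriv_nonneg {U : Set ℝ} (hU : IsOpen U) {φ g : ℝ → ℝ} {g' t : ℝ}
    (hφ : ConvexOn ℝ U φ) (hd : ∀ s ∈ U, HasDerivAt φ (g s) s) (ht : t ∈ U)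
    (hg : HasDerivAt g g' t) : 0 ≤ g' := by
  have hmono : MonotoneOn (deriv φ) U :=
    hφ.monotoneOn_deriv fun s hs => (hd s hs).differentiableAt
  have hmono' : MonotoneOn g U := hmono.congr fun s hs => (hd s hs).deriv
  have h1 : derivWithin g U t = g' := hg.hasDerivWithinAt.derivWithin (hU.uniqueDiffWithinAt ht)
  exact h1 ▸ hmono'.derivWithin_nonneg

/-- The Hessian of a convex `C²` function on an open set is positive semidefinite. -/
theorem hessQF_nonneg {d : ℕ} {U : Set (E d)} (hU : IsOpen U) {R : E d → ℝ}
    (hR : ContDiffOn ℝ 2 R U) (hc : ConvexOn ℝ U R) {p : E d} (hp : p ∈ U) (h : E d) :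
    0 ≤ hessQF R p h := by
  have hcd : ∀ q ∈ U, ContDiffAt ℝ 2 R q := fun q hq => hR.contDiffAt (hU.mem_nhds hq)
  have hmap : ∀ s : ℝ, AffineMap.lineMap p (p + h) s = p + s • h := fun s => by
    simp [AffineMap.lineMap_apply, add_comm]
  have hconv := hc.comp_affineMap (AffineMap.lineMap p (p + h) : ℝ →ᵃ[ℝ] E d)
  have hfun : R ∘ (AffineMap.lineMap p (p + h) : ℝ →ᵃ[ℝ] E d) = fun s : ℝ => R (p + s • h) := by
    funext s
    simp only [Function.comp_apply, hmap]
  have hset : (AffineMap.lineMap p (p + h) : ℝ →ᵃ[ℝ] E d) ⁻¹' U = {s : ℝ | p + s • h ∈ U} := by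
    ext s
    simp only [Set.mem_preimage, hmap, Set.mem_ofPred_eq]
  rw [hfun, hset] at hconv
  have hopen : IsOpen {s : ℝ | p + s • h ∈ U} :=
    hU.preimage (f := fun s : ℝ => p + s • h) (by fun_prop)
  have h0 : (0 : ℝ) ∈ {s : ℝ | p + s • h ∈ U} := by simpa using hp
  have := hconv.second_deriv_nonneg hopen
    (fun s hs => hasDerivAt_comp_line ((hcd _ hs).differentiableAt (by norm_num))) h0
    (hasDerivAt_fderiv_line (hcd _ h0))
  simpa using this

/-- If `(φ')² ≤ ϑ φ''` on `[0, T]` then `exp (-φ / ϑ)` is concave there, which bounds the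
growth of `φ` on `[0, 1]` for `T > 1`. -/
theorem sub_le_neg_mul_log_of_sq_deriv_le {φ g g' : ℝ → ℝ} {ϑ T : ℝ} (hϑ : 0 < ϑ) (hT : 1 < T)
    (hφ : ∀ t ∈ Set.Icc 0 T, HasDerivAt φ (g t) t)
    (hg : ∀ t ∈ Set.Icc 0 T, HasDerivAt g (g' t) t)
    (hle : ∀ t ∈ Set.Icc 0 T, g t ^ 2 ≤ ϑ * g' t) :
    φ 1 - φ 0 ≤ -ϑ * Real.log (1 - T⁻¹) := by
  have hT0 : 0 < T := by linarith
  have hF : ∀ t ∈ Set.Icc 0 T, HasDerivAt (fun t => Real.exp (-φ t / ϑ))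
      (Real.exp (-φ t / ϑ) * (-g t / ϑ)) t :=
    fun t ht => (((hφ t ht).neg).div_const ϑ).exp
  have hF' : ∀ t ∈ Set.Icc 0 T, HasDerivAt (fun t => Real.exp (-φ t / ϑ) * (-g t / ϑ))
      (Real.exp (-φ t / ϑ) * (-g t / ϑ) * (-g t / ϑ) + Real.exp (-φ t / ϑ) * (-g' t / ϑ)) t :=
    fun t ht => (hF t ht).mul (((hg t ht).neg).div_const ϑ)
  have hconc : ConcaveOn ℝ (Set.Icc 0 T) fun t => Real.exp (-φ t / ϑ) := by
    refine concaveOn_of_hasDerivWithinAt2_nonpos (convex_Icc 0 T)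
      (fun t ht => (hF t ht).continuousAt.continuousWithinAt)
      (fun t ht => (hF t (interior_subset ht)).hasDerivWithinAt)
      (fun t ht => (hF' t (interior_subset ht)).hasDerivWithinAt) fun t ht => ?_
    have h1 := hle t (interior_subset ht)
    have h2 : Real.exp (-φ t / ϑ) * (-g t / ϑ) * (-g t / ϑ)
        + Real.exp (-φ t / ϑ) * (-g' t / ϑ)
        = Real.exp (-φ t / ϑ) * ((g t ^ 2 - ϑ * g' t) / ϑ ^ 2) := by
      field_simp
      ring
    rw [h2]
    exact mul_nonpos_of_nonneg_of_nonpos (Real.exp_pos _).le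
      (div_nonpos_of_nonpos_of_nonneg (by linarith) (by positivity))
  have hTi : T⁻¹ < 1 := inv_lt_one_of_one_lt₀ hT
  have hkey := hconc.2 (Set.left_mem_Icc.2 hT0.le) (Set.right_mem_Icc.2 hT0.le)
    (sub_pos.2 hTi).le (inv_pos.2 hT0).le (by ring)
  simp only [smul_eq_mul, mul_zero, zero_add, inv_mul_cancel₀ hT0.ne'] at hkey
  have hlow : (1 - T⁻¹) * Real.exp (-φ 0 / ϑ) ≤ Real.exp (-φ 1 / ϑ) :=
    le_trans (le_add_of_nonneg_right (by positivity)) hkey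
  have hlog := Real.log_le_log (mul_pos (sub_pos.2 hTi) (Real.exp_pos _)) hlow
  rw [Real.log_mul (sub_pos.2 hTi).ne' (Real.exp_pos _).ne', Real.log_exp, Real.log_exp] at hlog
  have h3 := mul_le_mul_of_nonneg_left hlog hϑ.le
  have h4 : ϑ * (Real.log (1 - T⁻¹) + -φ 0 / ϑ) = ϑ * Real.log (1 - T⁻¹) - φ 0 := by
    field_simp
    ring
  have h5 : ϑ * (-φ 1 / ϑ) = -φ 1 := by field_simp
  rw [h4, h5] at h3
  linarith

/-- Points of the segment from an interior point `x` beyond `y`, strictly before leaving `K`,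
are interior. -/
theorem Convex.add_inv_smul_mem_interior_of_minkowskiFn_lt {d : ℕ} {K : Set (E d)}
    (hK : Convex ℝ K) {x y : E d} (hx : x ∈ interior K) (hy : y ∈ K) {s : ℝ}
    (hs : minkowskiFn K x y < s) : x + s⁻¹ • (y - x) ∈ interior K := by
  have hne : {t : ℝ | 0 < t ∧ x + t⁻¹ • (y - x) ∈ K}.Nonempty :=
    ⟨1, one_pos, by simpa using hy⟩
  obtain ⟨t, ⟨ht0, htK⟩, hts⟩ := exists_lt_of_csInf_lt hne hs
  have hs0 : 0 < s := ht0.trans hts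
  have h1 : t / s < 1 := (div_lt_one hs0).2 hts
  have := hK.combo_interior_self_mem_interior hx htK (a := 1 - t / s) (b := t / s)
    (by linarith) (by positivity) (by ring)
  convert this using 1
  have h2 : t / s * t⁻¹ = s⁻¹ := by field_simp
  rw [smul_add, smul_smul, h2, sub_smul, one_smul]
  abel

/-- The Minkowski function at an interior point is below `1` on the interior. -/
theorem minkowskiFn_lt_one {d : ℕ} {K : Set (E d)} {x y : E d} (hy : y ∈ interior K) :
    minkowskiFn K x y < 1 := by
  have hcont : ContinuousAt (fun t : ℝ => x + t⁻¹ • (y - x)) 1 := by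
    have : ContinuousAt (fun t : ℝ => t⁻¹) 1 := continuousAt_inv₀ one_ne_zero
    fun_prop
  have hev : ∀ᶠ t : ℝ in 𝓝 1, x + t⁻¹ • (y - x) ∈ interior K :=
    hcont.eventually (isOpen_interior.mem_nhds (by simpa using hy))
  have hev' : ∀ᶠ t : ℝ in 𝓝[<] 1, 0 < t ∧ x + t⁻¹ • (y - x) ∈ interior K ∧ t < 1 := by
    filter_upwards [nhdsWithin_le_nhds hev, nhdsWithin_le_nhds (lt_mem_nhds one_pos),
      self_mem_nhdsWithin] with t h1 h2 h3 using ⟨h2, h1, h3⟩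
  obtain ⟨t, ht0, htK, ht1⟩ := hev'.exists
  have hbdd : BddBelow {t : ℝ | 0 < t ∧ x + t⁻¹ • (y - x) ∈ K} := ⟨0, fun r hr => hr.1.le⟩
  exact (csInf_le hbdd ⟨ht0, interior_subset htK⟩).trans_lt ht1

/-- The Minkowski function is nonnegative. -/
theorem minkowskiFn_nonneg {d : ℕ} (K : Set (E d)) (x y : E d) : 0 ≤ minkowskiFn K x y :=
  Real.sInf_nonneg fun _ hr => hr.1.le

/-- For a `ϑ`-self-concordant barrier `R` on a convex set `K` with nonempty
interior, `R(y) - R(x) ≤ -ϑ ln(1 - π_x(y))` for all `x, y ∈ int K`. -/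
theorem statement2 {d : ℕ} (K : Set (E d)) (hKconv : Convex ℝ K)
    (hKint : (interior K).Nonempty) (ϑ : ℝ) (hϑ : 0 ≤ ϑ)
    (R : E d → ℝ) (hR : IsSelfConcordantBarrier K ϑ R)
    (x : E d) (hx : x ∈ interior K) (y : E d) (hy : y ∈ interior K) :
    R y - R x ≤ -ϑ * Real.log (1 - minkowskiFn K x y) := by
  obtain ⟨⟨hsmooth, hconv, -, -⟩, hbar⟩ := hR
  have hC2 : ContDiffOn ℝ 2 R (interior K) := hsmooth.of_le (by norm_num)
  have hcd : ∀ p ∈ interior K, ContDiffAt ℝ 2 R p :=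
    fun p hp => hC2.contDiffAt (isOpen_interior.mem_nhds hp)
  have hπ1 := minkowskiFn_lt_one (x := x) hy
  have hπ0 := minkowskiFn_nonneg K x y
  have key : ∀ s, minkowskiFn K x y < s → s < 1 → ∀ ε : ℝ, 0 < ε →
      R y - R x ≤ -(ϑ + ε) * Real.log (1 - s) := by
    intro s hs hs1 ε hε
    have hs0 : 0 < s := hπ0.trans_lt hs
    have hend := hKconv.add_inv_smul_mem_interior_of_minkowskiFn_lt hx (interior_subset hy) hs
    have hmem : ∀ t ∈ Set.Icc 0 s⁻¹, x + t • (y - x) ∈ interior K := by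
      intro t ht
      have := hKconv.interior.add_smul_mem hx hend (t := t * s)
        ⟨mul_nonneg ht.1 hs0.le, by
          simpa [hs0.ne'] using mul_le_mul_of_nonneg_right ht.2 hs0.le⟩
      rwa [smul_smul, mul_assoc, mul_inv_cancel₀ hs0.ne', mul_one] at this
    have := sub_le_neg_mul_log_of_sq_deriv_le (φ := fun t => R (x + t • (y - x)))
      (add_pos_of_nonneg_of_pos hϑ hε) ((one_lt_inv₀ hs0).2 hs1)
      (fun t ht => hasDerivAt_comp_line ((hcd _ (hmem t ht)).differentiableAt (by norm_num)))
      (fun t ht => hasDerivAt_fderiv_line (hcd _ (hmem t ht)))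
      (fun t ht => by
        have h0 := hessQF_nonneg isOpen_interior hC2 hconv (hmem t ht) (y - x)
        have h1 := sq_le_sq' (neg_le_of_abs_le (hbar _ (hmem t ht) (y - x)))
          (le_of_abs_le (hbar _ (hmem t ht) (y - x)))
        rw [Real.sq_sqrt (mul_nonneg hϑ h0)] at h1
        nlinarith [mul_nonneg hε.le h0])
    simpa using this
  have key' : ∀ s, minkowskiFn K x y < s → s < 1 → R y - R x ≤ -ϑ * Real.log (1 - s) := by
    intro s hs hs1
    have hlim : Tendsto (fun ε : ℝ => -(ϑ + ε) * Real.log (1 - s)) (𝓝[>] 0)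
        (𝓝 (-(ϑ + 0) * Real.log (1 - s))) :=
      (Continuous.tendsto (by fun_prop) 0).mono_left nhdsWithin_le_nhds
    rw [add_zero] at hlim
    exact ge_of_tendsto hlim (eventually_mem_nhdsWithin.mono fun ε hε => key s hs hs1 ε hε)
  have hlim : Tendsto (fun s : ℝ => -ϑ * Real.log (1 - s)) (𝓝[>] (minkowskiFn K x y))
      (𝓝 (-ϑ * Real.log (1 - minkowskiFn K x y))) := by
    have h1 : ContinuousAt (fun s : ℝ => -ϑ * Real.log (1 - s)) (minkowskiFn K x y) :=
      continuousAt_const.mul ((continuousAt_const.sub continuousAt_id).log (sub_pos.2 hπ1).ne')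
    exact h1.tendsto.mono_left nhdsWithin_le_nhds
  refine ge_of_tendsto hlim ?_
  filter_upwards [self_mem_nhdsWithin, nhdsWithin_le_nhds (gt_mem_nhds hπ1)] with s h1 h2
    using key' s h1 h2
end
end

section
/- For every convex body K ⊂ ℝ^d there exists a d-self-concordant barrier on K. -/
noncomputable section
open MeasureTheory ProbabilityTheory Real Filter Topology Matrix
open scoped RealInnerProductSpace

/-- The moments of the standard exponential distribution. -/
lemma integral_pow_mul_exp_neg_Ioi (k : ℕ) :
    ∫ t in Set.Ioi (0 : ℝ), t ^ k * exp (-t) = (k.factorial : ℝ) := by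
  rw [← Real.Gamma_nat_eq_factorial, Real.Gamma_eq_integral (by positivity)]
  refine setIntegral_congr_fun measurableSet_Ioi fun t _ => ?_
  simp [mul_comm]

lemma integrableOn_pow_mul_exp_neg_Ioi (k : ℕ) :
    IntegrableOn (fun t : ℝ => t ^ k * exp (-t)) (Set.Ioi 0) := by
  refine (Real.GammaIntegral_convergent (s := (k : ℝ) + 1) (by positivity)).congr_fun
    (fun t _ => ?_) measurableSet_Ioi
  simp [mul_comm]

/-- Among log-concave probability densities with mean `1` and second moment `2`, the standard
exponential density maximises the third moment. -/
lemma integral_pow_three_le_six {w : ℝ → ℝ} (hw : ConvexOn ℝ Set.univ w)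
    (hi : ∀ k : ℕ, Integrable fun s => s ^ k * exp (-w s))
    (h0 : ∫ s, exp (-w s) = 1) (h1 : ∫ s, s * exp (-w s) = 1)
    (h2 : ∫ s, s ^ 2 * exp (-w s) = 2) : ∫ s, s ^ 3 * exp (-w s) ≤ 6 := by
  set e : ℝ → ℝ := (Set.Ioi (0 : ℝ)).indicator fun t => exp (-t) with he
  have hek : ∀ k : ℕ, (fun s => s ^ k * e s)
      = (Set.Ioi (0 : ℝ)).indicator fun t => t ^ k * exp (-t) := by
    intro k; ext s; simp only [he, Set.indicator_apply]; split_ifs <;> simp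
  have hei : ∀ k : ℕ, Integrable fun s => s ^ k * e s := by
    intro k; rw [hek, integrable_indicator_iff measurableSet_Ioi]
    exact integrableOn_pow_mul_exp_neg_Ioi k
  have hem : ∀ k : ℕ, ∫ s, s ^ k * e s = (k.factorial : ℝ) := by
    intro k; rw [hek, integral_indicator measurableSet_Ioi, integral_pow_mul_exp_neg_Ioi]
  set D : ℝ → ℝ := fun s => exp (-w s) - e s with hD
  have hDi : ∀ k : ℕ, Integrable fun s => s ^ k * D s := by
    intro k
    simp only [hD, mul_sub]
    exact (hi k).sub (hei k)
  have hDm : ∀ k : ℕ, ∫ s, s ^ k * D s = (∫ s, s ^ k * exp (-w s)) - (k.factorial : ℝ) := by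
    intro k; rw [← hem k, ← integral_sub (hi k) (hei k)]; simp [hD, mul_sub]
  have d0 : ∫ s, s ^ 0 * D s = 0 := by rw [hDm]; simp [h0]
  have d1 : ∫ s, s ^ 1 * D s = 0 := by rw [hDm]; simp [h1]
  have d2 : ∫ s, s ^ 2 * D s = 0 := by rw [hDm]; simp [h2]
  have d3 : ∫ s, s ^ 3 * D s = (∫ s, s ^ 3 * exp (-w s)) - 6 := by
    rw [hDm]; norm_num [Nat.factorial]
  have hneg : ∀ s ≤ 0, 0 < D s := by
    intro s hs; simp [hD, he, Set.indicator_apply, not_lt.2 hs, exp_pos]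
  have hpos : ∀ s, 0 < s → D s = exp (-w s) - exp (-s) := by
    intro s hs; simp [hD, he, Set.indicator_apply, hs]
  have key : ∀ b c : ℝ, (∀ s, s * (s - b) * (s - c) * D s ≤ 0) →
      ∫ s, s ^ 3 * exp (-w s) ≤ 6 := by
    intro b c h
    have : ∫ s, s * (s - b) * (s - c) * D s
        = (∫ s, s ^ 3 * D s) - (b + c) * (∫ s, s ^ 2 * D s) + b * c * ∫ s, s ^ 1 * D s := by
      have hA : Integrable fun s => s ^ 3 * D s - (b + c) * (s ^ 2 * D s) :=
        (hDi 3).sub ((hDi 2).const_mul _)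
      rw [← integral_const_mul, ← integral_const_mul, ← integral_sub (hDi 3) ((hDi 2).const_mul _),
        ← integral_add hA ((hDi 1).const_mul _)]
      congr 1; ext s; ring
    have h' : ∫ s, s * (s - b) * (s - c) * D s ≤ 0 := integral_nonpos h
    rw [this, d1, d2, d3] at h'
    linarith
  set I : Set ℝ := {t | 0 < t ∧ w t ≤ t} with hI
  have hIconv : Convex ℝ I := by
    have h := (hw.sub (g := fun t : ℝ => t) (concaveOn_id convex_univ)).convex_le 0
    have h' := (convex_Ioi (0 : ℝ)).inter h
    have hIeq : I = Set.Ioi 0 ∩ {x | x ∈ Set.univ ∧ w x - x ≤ 0} := by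
      ext t; simp [hI]
    rw [hIeq]; exact h'
  have hIoc := hIconv.ordConnected
  have hout : ∀ s, 0 < s → s ∉ I → D s ≤ 0 := by
    intro s hs hsI
    have : s < w s := by by_contra hc; exact hsI ⟨hs, not_lt.1 hc⟩
    rw [hpos s hs, sub_nonpos]; exact exp_le_exp.2 (by linarith)
  have hin : ∀ s ∈ I, 0 ≤ D s := by
    intro s hs
    rw [hpos s hs.1, sub_nonneg]; exact exp_le_exp.2 (by linarith [hs.2])
  rcases I.eq_empty_or_nonempty with hE | hne
  · refine key 0 0 fun s => ?_
    rcases le_or_gt s 0 with hs | hs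
    · have := (hneg s hs).le
      have h3 : s * (s - 0) * (s - 0) ≤ 0 := by nlinarith [mul_nonneg (sq_nonneg s) (neg_nonneg.2 hs)]
      exact mul_nonpos_of_nonpos_of_nonneg h3 this
    · have := hout s hs (by simp [hE])
      exact mul_nonpos_of_nonneg_of_nonpos (by simp; positivity) this
  have hbb : BddBelow I := ⟨0, fun t ht => ht.1.le⟩
  have hb0 : 0 ≤ sInf I := le_csInf hne fun t ht => ht.1.le
  by_cases hba : BddAbove I
  · refine key (sInf I) (sSup I) fun s => ?_
    have hbc : sInf I ≤ sSup I := csInf_le_csSup hne hbb hba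
    rcases le_or_gt s 0 with hs | hs
    · have := (hneg s hs).le
      refine mul_nonpos_of_nonpos_of_nonneg ?_ this
      exact mul_nonpos_of_nonneg_of_nonpos
        (mul_nonneg_of_nonpos_of_nonpos hs (by linarith)) (by linarith)
    by_cases hsI : s ∈ I
    · refine mul_nonpos_of_nonpos_of_nonneg ?_ (hin s hsI)
      have h1 := csInf_le hbb hsI
      have h2 := le_csSup hba hsI
      exact mul_nonpos_of_nonneg_of_nonpos (mul_nonneg hs.le (by linarith)) (by linarith)
    · have hDs := hout s hs hsI
      refine mul_nonpos_of_nonneg_of_nonpos ?_ hDs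
      rcases le_or_gt s (sInf I) with h1 | h1
      · exact mul_nonneg_of_nonpos_of_nonpos
          (mul_nonpos_of_nonneg_of_nonpos hs.le (by linarith)) (by linarith)
      rcases le_or_gt (sSup I) s with h2 | h2
      · exact mul_nonneg (mul_nonneg hs.le (by linarith)) (by linarith)
      exfalso
      obtain ⟨x, hx, hxs⟩ := exists_lt_of_csInf_lt hne h1
      obtain ⟨y, hy, hys⟩ := exists_lt_of_lt_csSup hne h2
      exact hsI (hIoc.out hx hy ⟨hxs.le, hys.le⟩)
  · exfalso
    set b := sInf I
    have hnn : ∀ s, 0 ≤ s * (s - b) * D s := by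
      intro s
      rcases le_or_gt s 0 with hs | hs
      · exact mul_nonneg (mul_nonneg_of_nonpos_of_nonpos hs (by linarith)) (hneg s hs).le
      by_cases hsI : s ∈ I
      · exact mul_nonneg (mul_nonneg hs.le (by linarith [csInf_le hbb hsI])) (hin s hsI)
      · refine mul_nonneg_of_nonpos_of_nonpos ?_ (hout s hs hsI)
        refine mul_nonpos_of_nonneg_of_nonpos hs.le ?_
        by_contra hc
        obtain ⟨x, hx, hxs⟩ := exists_lt_of_csInf_lt hne (show b < s by linarith)
        obtain ⟨y, hy, hys⟩ := not_bddAbove_iff.1 hba s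
        exact hsI (hIoc.out hx hy ⟨hxs.le, hys.le⟩)
    have heq : (fun s => s * (s - b) * D s) = fun s => s ^ 2 * D s - b * (s ^ 1 * D s) := by
      ext s; ring
    have hcomp : Integrable fun s => s * (s - b) * D s := by
      rw [heq]; exact (hDi 2).sub ((hDi 1).const_mul _)
    have hz : ∫ s, s * (s - b) * D s = 0 := by
      rw [heq, integral_sub (hDi 2) ((hDi 1).const_mul _), integral_const_mul, d1, d2]; simp
    have hae := (integral_eq_zero_iff_of_nonneg hnn hcomp).1 hz
    have : volume (Set.Iio (0 : ℝ)) = 0 := by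
      refine measure_mono_null (fun s hs => ?_) hae
      have hs' : s < 0 := hs
      have : 0 < s * (s - b) * D s :=
        mul_pos (mul_pos_of_neg_of_neg hs' (by linarith)) (hneg s hs'.le)
      exact this.ne'
    simp at this

/-- Sharp one-sided third moment bound for log-concave densities on the line. -/
lemma third_central_moment_le {w : ℝ → ℝ} (hw : ConvexOn ℝ Set.univ w)
    (hi : ∀ k : ℕ, Integrable fun s => s ^ k * exp (-w s)) {m μ σ : ℝ} (hσ : 0 < σ) (hm : 0 < m)
    (h0 : ∫ s, exp (-w s) = m) (h1 : ∫ s, (s - μ) * exp (-w s) = 0)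
    (h2 : ∫ s, (s - μ) ^ 2 * exp (-w s) = σ ^ 2 * m) :
    ∫ s, (s - μ) ^ 3 * exp (-w s) ≤ 2 * σ ^ 3 * m := by
  have hci : ∀ k : ℕ, ∀ c : ℝ, Integrable fun s => (s - c) ^ k * exp (-w s) := by
    intro k
    induction k with
    | zero => intro c; simpa using hi 0
    | succ k ih =>
      intro c
      have hgen : ∀ j : ℕ, Integrable fun s => s ^ j * ((s - c) ^ k * exp (-w s)) := by
        clear ih
        induction k with
        | zero => intro j; simpa using hi j
        | succ k ih =>
          intro j
          have := (ih (j + 1)).sub ((ih j).const_mul c)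
          refine this.congr (Eventually.of_forall fun s => ?_)
          simp only [Pi.sub_apply]; ring
      have := (hgen 1).sub ((hgen 0).const_mul c)
      refine this.congr (Eventually.of_forall fun s => ?_)
      simp only [Pi.sub_apply]; ring
  set v : ℝ → ℝ := fun t => w (σ * t + (μ - σ)) - log (σ / m) with hv
  have hvexp : ∀ t, exp (-v t) = σ / m * exp (-w (σ * t + (μ - σ))) := by
    intro t
    rw [hv, neg_sub, sub_eq_add_neg, exp_add, exp_log (by positivity)]
  have hvc : ConvexOn ℝ Set.univ v := by
    have h := (hw.comp_affineMap (AffineMap.lineMap (μ - σ) μ : ℝ →ᵃ[ℝ] ℝ)).add_const (-log (σ / m))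
    rw [Set.preimage_univ] at h
    refine h.congr fun t _ => ?_
    simp [hv, AffineMap.lineMap_apply, sub_eq_add_neg, mul_comm]
  have hform : ∀ (k : ℕ) (t : ℝ), t ^ k * exp (-v t)
      = (fun s => σ / m * (((s - (μ - σ)) / σ) ^ k * exp (-w s))) (σ * t + (μ - σ)) := by
    intro k t
    have : (σ * t + (μ - σ) - (μ - σ)) / σ = t := by field_simp; ring
    simp only [hvexp, this]; ring
  have hform' : ∀ (k : ℕ) (s : ℝ), σ / m * (((s - (μ - σ)) / σ) ^ k * exp (-w s))
      = σ / m * (σ ^ k)⁻¹ * ((s - (μ - σ)) ^ k * exp (-w s)) := by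
    intro k s; rw [div_pow]; ring
  have hvi : ∀ k : ℕ, Integrable fun t => t ^ k * exp (-v t) := by
    intro k
    simp only [hform]
    have : Integrable (fun s => σ / m * (((s - (μ - σ)) / σ) ^ k * exp (-w s))) := by
      simp only [hform']; exact (hci k _).const_mul _
    exact (this.comp_add_right (μ - σ)).comp_mul_left' hσ.ne'
  have hvm : ∀ k : ℕ, ∫ t, t ^ k * exp (-v t)
      = (m * σ ^ k)⁻¹ * ∫ s, (s - (μ - σ)) ^ k * exp (-w s) := by
    intro k
    simp only [hform]
    have e1 := Measure.integral_comp_mul_left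
      (fun s => (fun s => σ / m * (((s - (μ - σ)) / σ) ^ k * exp (-w s))) (s + (μ - σ))) σ
    rw [e1, integral_add_right_eq_self
      (fun s => σ / m * (((s - (μ - σ)) / σ) ^ k * exp (-w s)))]
    simp only [hform', integral_const_mul, smul_eq_mul]
    rw [abs_of_pos (by positivity)]
    field_simp
  have h0' : ∫ s, (s - μ) ^ 0 * exp (-w s) = m := by simpa using h0
  have h1' : ∫ s, (s - μ) ^ 1 * exp (-w s) = 0 := by simpa using h1
  have k1 : ∫ s, (s - (μ - σ)) * exp (-w s) = σ * m := by
    have : ∀ s, (s - (μ - σ)) * exp (-w s)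
        = (s - μ) ^ 1 * exp (-w s) + σ * ((s - μ) ^ 0 * exp (-w s)) := by intro s; ring
    simp only [this]
    rw [integral_add (hci 1 μ) ((hci 0 μ).const_mul _), integral_const_mul, h0', h1', zero_add]
  have k2 : ∫ s, (s - (μ - σ)) ^ 2 * exp (-w s) = 2 * σ ^ 2 * m := by
    have : ∀ s, (s - (μ - σ)) ^ 2 * exp (-w s) = ((s - μ) ^ 2 * exp (-w s)
        + 2 * σ * ((s - μ) ^ 1 * exp (-w s))) + σ ^ 2 * ((s - μ) ^ 0 * exp (-w s)) := by
      intro s; ring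
    have hA : Integrable fun s => (s - μ) ^ 2 * exp (-w s)
        + 2 * σ * ((s - μ) ^ 1 * exp (-w s)) := (hci 2 μ).add ((hci 1 μ).const_mul _)
    simp only [this]
    rw [integral_add hA ((hci 0 μ).const_mul _), integral_add (hci 2 μ) ((hci 1 μ).const_mul _),
      integral_const_mul, integral_const_mul, h0', h1', h2]
    ring
  have k3 : ∫ s, (s - (μ - σ)) ^ 3 * exp (-w s)
      = (∫ s, (s - μ) ^ 3 * exp (-w s)) + 4 * σ ^ 3 * m := by
    have : ∀ s, (s - (μ - σ)) ^ 3 * exp (-w s) = (((s - μ) ^ 3 * exp (-w s)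
        + 3 * σ * ((s - μ) ^ 2 * exp (-w s))) + 3 * σ ^ 2 * ((s - μ) ^ 1 * exp (-w s)))
        + σ ^ 3 * ((s - μ) ^ 0 * exp (-w s)) := by
      intro s; ring
    have hA : Integrable fun s => (s - μ) ^ 3 * exp (-w s)
        + 3 * σ * ((s - μ) ^ 2 * exp (-w s)) := (hci 3 μ).add ((hci 2 μ).const_mul _)
    have hB : Integrable fun s => ((s - μ) ^ 3 * exp (-w s)
        + 3 * σ * ((s - μ) ^ 2 * exp (-w s))) + 3 * σ ^ 2 * ((s - μ) ^ 1 * exp (-w s)) :=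
      hA.add ((hci 1 μ).const_mul _)
    simp only [this]
    rw [integral_add hB ((hci 0 μ).const_mul _), integral_add hA ((hci 1 μ).const_mul _),
      integral_add (hci 3 μ) ((hci 2 μ).const_mul _),
      integral_const_mul, integral_const_mul, integral_const_mul, h0', h1', h2]
    ring
  have hv0 : ∫ t, exp (-v t) = 1 := by
    have := hvm 0
    simp only [pow_zero, one_mul, mul_one] at this
    rw [this, h0]; field_simp
  have hv1 : ∫ t, t * exp (-v t) = 1 := by
    have := hvm 1
    simp only [pow_one] at this
    rw [this, k1]; field_simp
  have hv2 : ∫ t, t ^ 2 * exp (-v t) = 2 := by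
    rw [hvm 2, k2]; field_simp
  have h6 := integral_pow_three_le_six hvc hvi hv0 hv1 hv2
  rw [hvm 3, k3, inv_mul_le_iff₀ (by positivity)] at h6
  linarith

/-- Sharp third central moment bound for log-concave densities on the line. -/
lemma abs_third_central_moment_le {w : ℝ → ℝ} (hw : ConvexOn ℝ Set.univ w)
    (hi : ∀ k : ℕ, Integrable fun s => s ^ k * exp (-w s)) {m μ σ : ℝ} (hσ : 0 < σ) (hm : 0 < m)
    (h0 : ∫ s, exp (-w s) = m) (h1 : ∫ s, (s - μ) * exp (-w s) = 0)
    (h2 : ∫ s, (s - μ) ^ 2 * exp (-w s) = σ ^ 2 * m) :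
    |∫ s, (s - μ) ^ 3 * exp (-w s)| ≤ 2 * σ ^ 3 * m := by
  refine abs_le.2 ⟨?_, third_central_moment_le hw hi hσ hm h0 h1 h2⟩
  have hneg : ∀ f : ℝ → ℝ, ∫ s, f (-s) = ∫ s, f s := fun f => integral_neg_eq_self f volume
  have hw' : ConvexOn ℝ Set.univ fun s => w (-s) := by
    have h := hw.comp_linearMap (-LinearMap.id : ℝ →ₗ[ℝ] ℝ)
    rw [Set.preimage_univ] at h
    exact h.congr fun t _ => by simp
  have key : ∀ k : ℕ, ∫ s, (s - -μ) ^ k * exp (-w (-s))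
      = (-1) ^ k * ∫ s, (s - μ) ^ k * exp (-w s) := by
    intro k
    rw [← hneg fun s => (s - μ) ^ k * exp (-w s), ← integral_const_mul]
    congr 1; ext s
    rw [← mul_assoc, ← mul_pow]; congr 2; ring
  have h := third_central_moment_le (w := fun s => w (-s)) (m := m) (μ := -μ) hw' (fun k => ?_)
    hσ hm (by rw [hneg fun s => exp (-w s), h0]) (by simpa [h1] using key 1)
    (by rw [key 2, h2]; ring)
  · rw [key 3] at h
    linarith
  · have := ((hi k).const_mul ((-1) ^ k)).comp_neg
    refine this.congr (Eventually.of_forall fun s => ?_)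
    simp only [← mul_assoc, ← mul_pow]; simp

lemma IsCompact.volume_add_le_volume_add {A B : Set ℝ} (hA : IsCompact A) (hB : IsCompact B)
    (hAn : A.Nonempty) (hBn : B.Nonempty) {C : Set ℝ} (hC : ∀ x ∈ A, ∀ y ∈ B, x + y ∈ C) :
    volume A + volume B ≤ volume C := by
  obtain ⟨x₀, hx₀, hx⟩ := hA.exists_isGreatest hAn
  obtain ⟨y₀, hy₀, hy⟩ := hB.exists_isLeast hBn
  have h1 : volume ((fun z => z + y₀) '' A) = volume A := by simp
  have h2 : volume ((fun z => x₀ + z) '' B) = volume B := by simp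
  rw [← h1, ← h2, ← measure_union₀]
  · refine measure_mono ?_
    rintro _ (⟨x, hxA, rfl⟩ | ⟨y, hyB, rfl⟩)
    · exact hC x hxA y₀ hy₀
    · exact hC x₀ hx₀ y hyB
  · exact (hB.image (by fun_prop)).measurableSet.nullMeasurableSet
  · refine measure_mono_null (t := {x₀ + y₀}) ?_ (by simp)
    rintro _ ⟨⟨x, hxA, rfl⟩, ⟨y, hyB, hxy⟩⟩
    have := hx hxA
    have := hy hyB
    simp only [Set.mem_singleton_iff] at hxy ⊢
    linarith

/-- The Brunn–Minkowski inequality on the line. -/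
lemma volume_add_le_of_add_mem {A B : Set ℝ} (hA : MeasurableSet A) (hB : MeasurableSet B)
    (hAn : A.Nonempty) (hBn : B.Nonempty) {C : Set ℝ} (hC : ∀ x ∈ A, ∀ y ∈ B, x + y ∈ C) :
    volume A + volume B ≤ volume C := by
  obtain ⟨x₀, hx₀⟩ := hAn
  obtain ⟨y₀, hy₀⟩ := hBn
  rw [hA.measure_eq_iSup_isCompact, hB.measure_eq_iSup_isCompact]
  simp only [iSup_and']
  refine ENNReal.biSup_add_biSup_le' ⟨∅, by simp⟩ ⟨∅, by simp⟩ fun K hK L hL => ?_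
  calc volume K + volume L ≤ volume (insert x₀ K) + volume (insert y₀ L) := by
        gcongr <;> exact Set.subset_insert _ _
    _ ≤ volume C := by
        refine (hK.2.insert x₀).volume_add_le_volume_add (hL.2.insert y₀)
          (Set.insert_nonempty _ _) (Set.insert_nonempty _ _) fun x hx y hy => hC x ?_ y ?_
        · exact Set.insert_subset hx₀ hK.1 hx
        · exact Set.insert_subset hy₀ hL.1 hy

lemma volume_combo_le {A B : Set ℝ} (hA : MeasurableSet A) (hB : MeasurableSet B)
    (hAn : A.Nonempty) (hBn : B.Nonempty) {a b : ℝ} (ha : 0 < a) (hb : 0 < b) {C : Set ℝ}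
    (hC : ∀ x ∈ A, ∀ y ∈ B, a * x + b * y ∈ C) :
    ENNReal.ofReal a * volume A + ENNReal.ofReal b * volume B ≤ volume C := by
  have h : ∀ c : ℝ, 0 < c → ∀ S : Set ℝ, ENNReal.ofReal c * volume S
      = volume ((fun x => c * x) '' S) := by
    intro c hc S
    have := Measure.addHaar_smul (volume : Measure ℝ) c S
    simp only [Module.finrank_self, pow_one, abs_of_pos hc] at this
    rw [← this]; rfl
  have hm : ∀ c : ℝ, 0 < c → ∀ S : Set ℝ, MeasurableSet S →
      MeasurableSet ((fun x => c * x) '' S) := fun c hc S hS =>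
    (measurableEmbedding_mulLeft₀ hc.ne').measurableSet_image.2 hS
  rw [h a ha, h b hb]
  refine volume_add_le_of_add_mem (hm a ha A hA) (hm b hb B hB) (hAn.image _) (hBn.image _) ?_
  rintro _ ⟨x, hx, rfl⟩ _ ⟨y, hy, rfl⟩
  exact hC x hx y hy

/-- The Prékopa–Leindler inequality on the line, in terms of logarithms. -/
lemma prekopa_leindler_real {p q r : ℝ → ℝ} (hp : Measurable p) (hq : Measurable q)
    (hr : Measurable r) (hpb : BddAbove (Set.range p)) (hqb : BddAbove (Set.range q))
    (hpi : Integrable fun t => exp (p t)) (hqi : Integrable fun t => exp (q t))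
    (hri : Integrable fun t => exp (r t)) {a b : ℝ} (ha : 0 < a) (hb : 0 < b) (hab : a + b = 1)
    (h : ∀ s t, a * p s + b * q t ≤ r (a * s + b * t)) :
    a * log (∫ t, exp (p t)) + b * log (∫ t, exp (q t)) ≤ log (∫ t, exp (r t)) := by
  set P := sSup (Set.range p)
  set Q := sSup (Set.range q)
  have hpP : ∀ t, p t ≤ P := fun t => le_csSup hpb ⟨t, rfl⟩
  have hqQ : ∀ t, q t ≤ Q := fun t => le_csSup hqb ⟨t, rfl⟩
  have hshift : ∀ (f : ℝ → ℝ) (c : ℝ), ∫ t, exp (f t - c) = exp (-c) * ∫ t, exp (f t) := by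
    intro f c
    rw [← integral_const_mul]; congr 1; ext t; rw [← exp_add]; ring_nf
  have hshifti : ∀ (f : ℝ → ℝ) (c : ℝ), Integrable (fun t => exp (f t)) →
      Integrable fun t => exp (f t - c) := by
    intro f c hf
    refine (hf.const_mul (exp (-c))).congr (Eventually.of_forall fun t => ?_)
    simp only [← exp_add]; ring_nf
  have hlay : ∀ (f : ℝ → ℝ), Measurable f → ∫⁻ t, ENNReal.ofReal (exp (f t))
      = ∫⁻ τ in Set.Ioi (0 : ℝ), volume {t | τ < exp (f t)} := fun f hf =>
    lintegral_eq_lintegral_meas_lt _ (Eventually.of_forall fun t => (exp_pos _).le)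
      hf.exp.aemeasurable
  have hmeas : ∀ f : ℝ → ℝ, Measurable fun τ : ℝ => volume {t | τ < exp (f t)} := fun f =>
    Antitone.measurable fun s t hst => measure_mono fun x hx => lt_of_le_of_lt hst hx
  have hEN : ENNReal.ofReal a * (∫⁻ t, ENNReal.ofReal (exp (p t - P)))
      + ENNReal.ofReal b * (∫⁻ t, ENNReal.ofReal (exp (q t - Q)))
      ≤ ∫⁻ t, ENNReal.ofReal (exp (r t - (a * P + b * Q))) := by
    rw [hlay _ (hp.sub_const _), hlay _ (hq.sub_const _), hlay _ (hr.sub_const _),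
      ← lintegral_const_mul _ (hmeas _), ← lintegral_const_mul _ (hmeas _),
      ← lintegral_add_left ((hmeas _).const_mul _)]
    refine setLIntegral_mono (hmeas _) fun τ hτ => ?_
    have hτ0 : 0 < τ := hτ
    rcases lt_or_ge τ 1 with h1 | h1
    · have hlog : log τ < 0 := log_neg hτ0 h1
      have hset : ∀ f : ℝ → ℝ, ∀ x, τ < exp (f x) ↔ log τ < f x := fun f x =>
        (log_lt_iff_lt_exp hτ0).symm
      refine volume_combo_le (measurableSet_lt measurable_const (hp.sub_const _).exp)
        (measurableSet_lt measurable_const (hq.sub_const _).exp) ?_ ?_ ha hb ?_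
      · obtain ⟨_, ⟨x, rfl⟩, hx⟩ := exists_lt_of_lt_csSup (Set.range_nonempty p)
          (show P + log τ < P by linarith)
        exact ⟨x, (hset (fun x => p x - P) x).2 (by linarith)⟩
      · obtain ⟨_, ⟨x, rfl⟩, hx⟩ := exists_lt_of_lt_csSup (Set.range_nonempty q)
          (show Q + log τ < Q by linarith)
        exact ⟨x, (hset (fun x => q x - Q) x).2 (by linarith)⟩
      · intro x hx y hy
        have hx' := (hset (fun x => p x - P) x).1 hx
        have hy' := (hset (fun x => q x - Q) y).1 hy
        refine (hset (fun t => r t - (a * P + b * Q)) _).2 ?_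
        have := h x y
        have e : log τ = a * log τ + b * log τ := by rw [← add_mul, hab, one_mul]
        rw [e]
        nlinarith [mul_lt_mul_of_pos_left hx' ha, mul_lt_mul_of_pos_left hy' hb]
    · have hemp : ∀ (f : ℝ → ℝ) (c : ℝ), (∀ t, f t ≤ c) → {t | τ < exp (f t - c)} = ∅ := by
        intro f c hf
        refine Set.eq_empty_iff_forall_notMem.2 fun t ht => ?_
        have ht' : τ < exp (f t - c) := ht
        refine not_lt.2 ?_ ht'
        exact (exp_le_one_iff.2 (by linarith [hf t])).trans h1
      simp [hemp p P hpP, hemp q Q hqQ]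
  have hpos : ∀ f : ℝ → ℝ, Integrable (fun t => exp (f t)) → 0 < ∫ t, exp (f t) := by
    intro f hf; exact integral_exp_pos hf
  have hof : ∀ f : ℝ → ℝ, Integrable (fun t => exp (f t)) →
      ∫⁻ t, ENNReal.ofReal (exp (f t)) = ENNReal.ofReal (∫ t, exp (f t)) := fun f hf =>
    (ofReal_integral_eq_lintegral_ofReal hf (Eventually.of_forall fun t => (exp_pos _).le)).symm
  have hpi' := hshifti p P hpi
  have hqi' := hshifti q Q hqi
  have hri' := hshifti r (a * P + b * Q) hri
  have hp0 := hpos _ hpi'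
  have hq0 := hpos _ hqi'
  have hr0 := hpos _ hri'
  rw [hof _ hpi', hof _ hqi', hof _ hri', ← ENNReal.ofReal_mul ha.le, ← ENNReal.ofReal_mul hb.le,
    ← ENNReal.ofReal_add (by positivity) (by positivity), ENNReal.ofReal_le_ofReal_iff hr0.le]
    at hEN
  have hconc := strictConcaveOn_log_Ioi.concaveOn.2 hp0 hq0 ha.le hb.le hab
  have hle := hconc.trans (log_le_log (by simp only [smul_eq_mul]; positivity) hEN)
  have hlogs : ∀ (f : ℝ → ℝ) (c : ℝ), Integrable (fun t => exp (f t)) →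
      log (∫ t, exp (f t - c)) = log (∫ t, exp (f t)) - c := by
    intro f c hf
    rw [hshift, log_mul (exp_pos _).ne' (hpos f hf).ne', log_exp]; ring
  rw [hlogs p P hpi, hlogs q Q hqi, hlogs r _ hri] at hle
  simp only [smul_eq_mul] at hle
  linarith

lemma ConvexOn.continuous_real {w : ℝ → ℝ} (hw : ConvexOn ℝ Set.univ w) : Continuous w :=
  continuousOn_univ.1 (hw.continuousOn isOpen_univ)

/-- Prékopa's theorem: integrating out one real variable preserves log-concavity. -/
lemma ConvexOn.neg_log_integral_exp_neg {V : Type*} [AddCommGroup V] [Module ℝ V]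
    {u : V × ℝ → ℝ} (hu : ConvexOn ℝ Set.univ u)
    (hb : ∀ x, BddBelow (Set.range fun t => u (x, t)))
    (hi : ∀ x, Integrable fun t => exp (-u (x, t))) :
    ConvexOn ℝ Set.univ fun x => -log (∫ t, exp (-u (x, t))) := by
  have hm : ∀ x, Measurable fun t => -u (x, t) := by
    intro x
    have h := hu.comp_affineMap (AffineMap.lineMap (x, (0 : ℝ)) (x, (1 : ℝ)) : ℝ →ᵃ[ℝ] V × ℝ)
    rw [Set.preimage_univ] at h
    have h' : ConvexOn ℝ Set.univ fun t => u (x, t) := h.congr fun t _ => by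
      simp [AffineMap.lineMap_apply]
    exact h'.continuous_real.measurable.neg
  have hbb : ∀ x, BddAbove (Set.range fun t => -u (x, t)) := by
    intro x
    obtain ⟨c, hc⟩ := hb x
    refine ⟨-c, ?_⟩
    rintro _ ⟨t, rfl⟩
    exact neg_le_neg (hc ⟨t, rfl⟩)
  refine convexOn_iff_forall_pos.2 ⟨convex_univ, fun x _ y _ a b ha hb' hab => ?_⟩
  have := prekopa_leindler_real (hm x) (hm y) (hm (a • x + b • y)) (hbb x) (hbb y) (hi x) (hi y)
    (hi _) ha hb' hab fun s t => by
      have := hu.2 (Set.mem_univ (x, s)) (Set.mem_univ (y, t)) ha.le hb'.le hab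
      simp only [Prod.smul_mk, Prod.mk_add_mk, smul_eq_mul] at this
      linarith
  simp only [smul_eq_mul]
  linarith

lemma integrable_exp_neg_mul_abs {c : ℝ} (hc : 0 < c) : Integrable fun t : ℝ => exp (-(c * |t|)) := by
  have h : IntegrableOn (fun t : ℝ => exp (-c * t)) (Set.Ioi 0) := integrableOn_exp_mul_Ioi (by linarith) 0
  have h1 : IntegrableOn (fun t : ℝ => exp (-(c * |t|))) (Set.Ioi 0) := by
    refine h.congr_fun (fun t ht => ?_) measurableSet_Ioi
    simp [abs_of_pos (Set.mem_Ioi.1 ht)]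
  have h2 : IntegrableOn (fun t : ℝ => exp (-(c * |t|))) (Set.Iic 0) := by
    have h : IntegrableOn (fun t : ℝ => exp (c * t)) (Set.Iic 0) := integrableOn_exp_mul_Iic hc 0
    refine h.congr_fun (fun t ht => ?_) measurableSet_Iic
    simp [abs_of_nonpos (Set.mem_Iic.1 ht)]
  rw [← integrableOn_univ, ← Set.Iic_union_Ioi (a := (0 : ℝ))]
  exact h2.union h1

/-- The first marginal of a log-concave density on `ℝⁿ⁺¹` with exponential decay is a log-concave
density with exponential decay. -/
lemma exists_convexOn_marginal (n : ℕ) {u : (Fin (n + 1) → ℝ) → ℝ} (hu : ConvexOn ℝ Set.univ u)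
    {c C : ℝ} (hc : 0 < c) (hb : ∀ y, c * ∑ i, |y i| - C ≤ u y) :
    ∃ (w : ℝ → ℝ) (C' : ℝ), ConvexOn ℝ Set.univ w ∧ (∀ s, c * |s| - C' ≤ w s) ∧
      ∀ φ : ℝ → ENNReal, Measurable φ →
        ∫⁻ y, φ (y 0) * ENNReal.ofReal (exp (-u y)) = ∫⁻ s, φ s * ENNReal.ofReal (exp (-w s)) := by
  induction n generalizing C with
  | zero =>
    refine ⟨fun s => u fun _ => s, C, ?_, fun s => by simpa using hb fun _ => s, fun φ hφ => ?_⟩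
    · have h := hu.comp_linearMap (LinearMap.pi fun _ => LinearMap.id : ℝ →ₗ[ℝ] (Fin 1 → ℝ))
      rw [Set.preimage_univ] at h
      exact h.congr fun t _ => rfl
    · have hv := (volume_preserving_funUnique (Fin 1) ℝ).symm
      have h := hv.lintegral_comp_emb (MeasurableEquiv.measurableEmbedding _)
        fun y => φ (y 0) * ENNReal.ofReal (exp (-u y))
      exact h.symm
  | succ n ih =>
    set ι : (Fin (n + 1) → ℝ) × ℝ →ₗ[ℝ] (Fin (n + 2) → ℝ) :=
      { toFun := fun p => Fin.snoc p.1 p.2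
        map_add' := fun p q => by
          ext i; refine Fin.lastCases ?_ (fun i => ?_) i <;> simp
        map_smul' := fun a p => by
          ext i; refine Fin.lastCases ?_ (fun i => ?_) i <;> simp } with hι
    have hι' : ∀ p, ι p = Fin.snoc p.1 p.2 := fun p => rfl
    have hu' : ConvexOn ℝ Set.univ fun p => u (ι p) := by
      have h := hu.comp_linearMap ι
      rw [Set.preimage_univ] at h
      exact h
    have hb' : ∀ x t, c * ∑ i, |x i| + c * |t| - C ≤ u (ι (x, t)) := by
      intro x t
      have := hb (ι (x, t))
      rw [Fin.sum_univ_castSucc] at this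
      simp only [hι', Fin.snoc_castSucc, Fin.snoc_last] at this
      rw [mul_add] at this
      exact this
    have hum : Continuous fun p => u (ι p) :=
      continuousOn_univ.1 (hu'.continuousOn isOpen_univ)
    have hux : ∀ x, Continuous fun t => u (ι (x, t)) := fun x =>
      hum.comp (by fun_prop : Continuous fun t : ℝ => (x, t))
    have hi : ∀ x, Integrable fun t => exp (-u (ι (x, t))) := by
      intro x
      refine ((integrable_exp_neg_mul_abs hc).const_mul (exp (C - c * ∑ i, |x i|))).mono' ?_ ?_
      · exact (continuous_exp.comp (hux x).neg).aestronglyMeasurable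
      · refine Eventually.of_forall fun t => ?_
        rw [norm_of_nonneg (exp_pos _).le, ← exp_add]
        exact exp_le_exp.2 (by linarith [hb' x t])
    have hv := hu'.neg_log_integral_exp_neg (fun x => ⟨c * ∑ i, |x i| - C, ?_⟩) hi
    swap
    · rintro _ ⟨t, rfl⟩
      have := hb' x t
      have : 0 ≤ c * |t| := by positivity
      simp only
      linarith
    have hJ : 0 < ∫ t : ℝ, exp (-(c * |t|)) := integral_exp_pos (integrable_exp_neg_mul_abs hc)
    obtain ⟨w, C', hw, hwb, hlaw⟩ := ih hv (C := C + log (∫ t : ℝ, exp (-(c * |t|)))) fun x => by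
      have h1 : ∫ t, exp (-u (ι (x, t)))
          ≤ exp (C - c * ∑ i, |x i|) * ∫ t : ℝ, exp (-(c * |t|)) := by
        rw [← integral_const_mul]
        refine integral_mono (hi x) ((integrable_exp_neg_mul_abs hc).const_mul _) fun t => ?_
        simp only [← exp_add]
        exact exp_le_exp.2 (by linarith [hb' x t])
      have h2 := log_le_log (integral_exp_pos (hi x)) h1
      rw [log_mul (exp_pos _).ne' hJ.ne', log_exp] at h2
      linarith
    refine ⟨w, C', hw, hwb, fun φ hφ => ?_⟩
    rw [← hlaw φ hφ]
    have hmp := (volume_preserving_piFinSuccAbove (fun _ : Fin (n + 2) => ℝ) (Fin.last _)).symm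
    rw [← hmp.lintegral_comp_emb (MeasurableEquiv.measurableEmbedding _)]
    have hsymm : ∀ (t : ℝ) (x : Fin (n + 1) → ℝ),
        (MeasurableEquiv.piFinSuccAbove (fun _ : Fin (n + 2) => ℝ) (Fin.last _)).symm (t, x)
          = ι (x, t) := by
      intro t x
      rw [hι']
      exact Fin.insertNth_last' t x
    have hmeas : Measurable fun p : ℝ × (Fin (n + 1) → ℝ) =>
        φ (ι (p.2, p.1) 0) * ENNReal.ofReal (exp (-u (ι (p.2, p.1)))) := by
      have h0 : ∀ p : ℝ × (Fin (n + 1) → ℝ), ι (p.2, p.1) 0 = p.2 0 := fun p =>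
        Fin.snoc_castSucc (α := fun _ => ℝ) p.1 p.2 0
      simp only [h0]
      have : Measurable fun p : ℝ × (Fin (n + 1) → ℝ) => u (ι (p.2, p.1)) :=
        (hum.comp continuous_swap).measurable
      exact (hφ.comp ((measurable_pi_apply 0).comp measurable_snd)).mul
        this.neg.exp.ennreal_ofReal
    rw [Measure.volume_eq_prod, lintegral_prod_symm _ 
      (hmeas.aemeasurable.congr (Eventually.of_forall fun p => by
        simp only [← hsymm, Prod.mk.eta]))]
    refine lintegral_congr fun x => ?_
    have h0 : ∀ t, ι (x, t) 0 = x 0 := fun t => Fin.snoc_castSucc (α := fun _ => ℝ) t x 0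
    simp only [hsymm, h0]
    have hmx : Measurable fun t => ENNReal.ofReal (exp (-u (ι (x, t)))) :=
      (hux x).measurable.neg.exp.ennreal_ofReal
    rw [lintegral_const_mul _ hmx, neg_neg, exp_log (integral_exp_pos (hi x)),
      ofReal_integral_eq_lintegral_ofReal (hi x) (Eventually.of_forall fun t => (exp_pos _).le)]

lemma exists_convexOn_marginal_inner {d : ℕ} {u : E d → ℝ} (hu : ConvexOn ℝ Set.univ u)
    (huc : Continuous u) {c C : ℝ} (hc : 0 < c) (hb : ∀ y, c * ‖y‖ - C ≤ u y) {v : E d}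
    (hv : ‖v‖ = 1) :
    ∃ (w : ℝ → ℝ) (c' C' : ℝ), 0 < c' ∧ ConvexOn ℝ Set.univ w ∧ (∀ s, c' * |s| - C' ≤ w s) ∧
      ∀ φ : ℝ → ENNReal, Measurable φ → ∫⁻ y, φ ⟪v, y⟫ * ENNReal.ofReal (exp (-u y)) =
        ∫⁻ s, φ s * ENNReal.ofReal (exp (-w s)) := by
  obtain _ | n := d
  · rw [Subsingleton.elim v 0, norm_zero] at hv
    exact absurd hv zero_ne_one
  obtain ⟨b, hb0⟩ := Orthonormal.exists_orthonormalBasis_extension_of_card_eq (𝕜 := ℝ)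
    (E := E (n + 1)) (ι := Fin (n + 1)) (v := fun _ => v) (s := {0}) (by simp) (by
      rw [orthonormal_iff_ite]
      rintro ⟨i, hi⟩ ⟨j, hj⟩
      obtain rfl : i = 0 := hi
      obtain rfl : j = 0 := hj
      simp [Set.domRestrict, hv])
  have hbv : b 0 = v := hb0 0 rfl
  let T : (Fin (n + 1) → ℝ) → E (n + 1) := fun z => b.repr.symm (WithLp.toLp 2 z)
  have hT : MeasurePreserving T volume volume :=
    b.measurePreserving_repr_symm.comp (PiLp.volume_preserving_toLp (Fin (n + 1)))
  have hTlin : ∀ (a a' : ℝ) z z', T (a • z + a' • z') = a • T z + a' • T z' := by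
    intro a a' z z'
    simp [T, WithLp.toLp_add, WithLp.toLp_smul]
  have hTin : ∀ z, ⟪v, T z⟫ = z 0 := by
    intro z
    rw [← hbv, ← b.repr_apply_apply]
    simp [T]
  have hTn : ∀ z, ∑ i, |z i| ≤ (n + 1) * ‖T z‖ := by
    intro z
    have : ‖T z‖ = ‖(WithLp.toLp 2 z : E (n + 1))‖ := by simp [T]
    rw [this]
    calc ∑ i, |z i| ≤ ∑ i : Fin (n + 1), ‖(WithLp.toLp 2 z : E (n + 1))‖ :=
          Finset.sum_le_sum fun i _ => PiLp.norm_apply_le (WithLp.toLp 2 z : E (n + 1)) i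
      _ = _ := by simp
  obtain ⟨w, C', hw, hwb, hφ⟩ := exists_convexOn_marginal n (u := fun z => u (T z))
    ⟨convex_univ, fun x _ y _ a a' ha ha' haa => by
      beta_reduce; rw [hTlin]; exact hu.2 trivial trivial ha ha' haa⟩
    (c := c / (n + 1)) (C := C) (by positivity) (fun z => by
      refine le_trans ?_ (hb (T z))
      have := mul_le_mul_of_nonneg_left (hTn z) (show 0 ≤ c / (n + 1) by positivity)
      have e : c / (n + 1) * ((n + 1) * ‖T z‖) = c * ‖T z‖ := by field_simp
      linarith)
  refine ⟨w, c / (n + 1), C', by positivity, hw, hwb, fun φ hm => ?_⟩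
  rw [← hφ φ hm, ← hT.lintegral_comp]
  · simp only [hTin]
  · exact (hm.comp (by fun_prop)).mul (by fun_prop)

lemma integrable_pow_mul_exp_neg_of_le {w : ℝ → ℝ} (hw : Continuous w) {c C : ℝ} (hc : 0 < c)
    (hb : ∀ s, c * |s| - C ≤ w s) (k : ℕ) : Integrable fun s => s ^ k * exp (-w s) := by
  have h := (integrable_exp_neg_mul_abs (half_pos hc)).const_mul
    (k.factorial * (2 / c) ^ k * exp C)
  refine h.mono' (by fun_prop) (ae_of_all _ fun s => ?_)
  have h1 := Real.pow_div_factorial_le_exp (c / 2 * |s|) (by positivity) k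
  have h2 : |s| ^ k ≤ k.factorial * (2 / c) ^ k * exp (c / 2 * |s|) := by
    rw [div_le_iff₀ (by positivity)] at h1
    have e : |s| ^ k = (2 / c) ^ k * (c / 2 * |s|) ^ k := by
      rw [← mul_pow]; congr 1; field_simp
    rw [e]
    calc _ ≤ (2 / c) ^ k * (exp (c / 2 * |s|) * k.factorial) := by gcongr
      _ = _ := by ring
  have h3 : exp (-w s) ≤ exp C * (exp (-(c / 2 * |s|)) * exp (-(c / 2 * |s|))) := by
    rw [← exp_add, ← exp_add]
    exact exp_le_exp.2 (by linarith [hb s])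
  rw [norm_mul, norm_pow, norm_eq_abs, norm_eq_abs, abs_exp]
  calc |s| ^ k * exp (-w s) ≤ (k.factorial * (2 / c) ^ k * exp (c / 2 * |s|)) *
        (exp C * (exp (-(c / 2 * |s|)) * exp (-(c / 2 * |s|)))) := by gcongr
    _ = k.factorial * (2 / c) ^ k * exp C * exp (-(c / 2 * |s|)) *
          (exp (c / 2 * |s|) * exp (-(c / 2 * |s|))) := by ring
    _ = _ := by rw [← exp_add]; simp

/-- The third central moment of a linear functional under a log-concave density is controlled by
its variance. -/
lemma abs_third_moment_inner_le {d : ℕ} {u : E d → ℝ} (hu : ConvexOn ℝ Set.univ u)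
    (huc : Continuous u) {c C : ℝ} (hc : 0 < c) (hb : ∀ y, c * ‖y‖ - C ≤ u y) {v : E d}
    {m M V : ℝ} (hm : 0 < m) (hV : 0 ≤ V) (h0 : ∫ y, exp (-u y) = m)
    (h1 : ∫ y, (⟪v, y⟫ - M) * exp (-u y) = 0)
    (h2 : ∫ y, (⟪v, y⟫ - M) ^ 2 * exp (-u y) = V * m) :
    |∫ y, (⟪v, y⟫ - M) ^ 3 * exp (-u y)| ≤ 2 * V ^ (3 / 2 : ℝ) * m := by
  rcases eq_or_ne v 0 with rfl | hv
  · simp only [inner_zero_left, zero_sub, integral_const_mul, h0] at h1 ⊢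
    have hM : M = 0 := by simpa [hm.ne'] using h1
    subst hM
    simp only [neg_zero, ne_eq, OfNat.ofNat_ne_zero, not_false_eq_true, zero_pow, zero_mul, abs_zero]
    positivity
  have hn : 0 < ‖v‖ := norm_pos_iff.2 hv
  obtain ⟨w, c', C', hc', hw, hwb, hφ⟩ := exists_convexOn_marginal_inner hu huc hc hb
    (v := ‖v‖⁻¹ • v) (by rw [norm_smul, norm_inv, norm_norm, inv_mul_cancel₀ hn.ne'])
  have hwc : Continuous w := hw.continuous_real
  have hmap : (volume.withDensity fun y => ENNReal.ofReal (exp (-u y))).map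
      (fun y => ⟪‖v‖⁻¹ • v, y⟫) = volume.withDensity fun s => ENNReal.ofReal (exp (-w s)) := by
    have hme : Measurable fun y : E d => ⟪‖v‖⁻¹ • v, y⟫ := by fun_prop
    ext s hs
    rw [Measure.map_apply hme hs, withDensity_apply _ (hme hs), withDensity_apply _ hs,
      ← lintegral_indicator (hme hs), ← lintegral_indicator hs]
    refine (lintegral_congr fun y => ?_).trans
      ((hφ (s.indicator 1) (measurable_one.indicator hs)).trans (lintegral_congr fun y => ?_))
    · by_cases h : ⟪‖v‖⁻¹ • v, y⟫ ∈ s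
      · rw [Set.indicator_of_mem (show y ∈ _ from h), Set.indicator_of_mem h]; simp
      · rw [Set.indicator_of_notMem (show y ∉ _ from h), Set.indicator_of_notMem h]; simp
    · by_cases h : y ∈ s
      · rw [Set.indicator_of_mem h, Set.indicator_of_mem h]; simp
      · rw [Set.indicator_of_notMem h, Set.indicator_of_notMem h]; simp
  have hcomp : ∀ f : ℝ → ℝ, Continuous f →
      ∫ y, f (⟪v, y⟫ / ‖v‖) * exp (-u y) = ∫ s, f s * exp (-w s) := by
    intro f hf
    have e1 : ∫ s, f s * exp (-w s) =
        ∫ s, f s ∂(volume.withDensity fun s => ENNReal.ofReal (exp (-w s))) := by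
      rw [integral_withDensity_eq_integral_toReal_smul (by fun_prop) (by simp)]
      exact integral_congr_ae (ae_of_all _ fun s => by
        simp [ENNReal.toReal_ofReal (exp_pos _).le, mul_comm])
    rw [e1, ← hmap, integral_map (by fun_prop) (by fun_prop),
      integral_withDensity_eq_integral_toReal_smul (by fun_prop) (by simp)]
    exact integral_congr_ae (ae_of_all _ fun s => by
        simp [ENNReal.toReal_ofReal (exp_pos _).le, mul_comm, inner_smul_left, div_eq_mul_inv])
  have hcomp' : ∀ k : ℕ, ∫ y, (⟪v, y⟫ - M) ^ k * exp (-u y) =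
      ‖v‖ ^ k * ∫ s, (s - M / ‖v‖) ^ k * exp (-w s) := by
    intro k
    rw [← hcomp (fun s => (s - M / ‖v‖) ^ k) (by fun_prop), ← integral_const_mul]
    refine integral_congr_ae (ae_of_all _ fun y => ?_)
    simp only
    rw [← mul_assoc, ← mul_pow, mul_sub, mul_div_cancel₀ _ hn.ne', mul_div_cancel₀ _ hn.ne']
  have hi := integrable_pow_mul_exp_neg_of_le hwc hc' hwb
  have k0 : ∫ s, exp (-w s) = m := by
    have := hcomp' 0
    simp only [pow_zero, one_mul] at this
    rw [← this, h0]
  have k1 : ∫ s, (s - M / ‖v‖) * exp (-w s) = 0 := by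
    have := hcomp' 1
    simp only [pow_one, h1] at this
    simpa [hn.ne'] using this.symm
  have k2 : ‖v‖ ^ 2 * ∫ s, (s - M / ‖v‖) ^ 2 * exp (-w s) = V * m := by rw [← hcomp', h2]
  have hVpos : 0 < V := by
    refine hV.lt_of_ne' fun hV0 => ?_
    rw [hV0, zero_mul, mul_eq_zero, or_iff_right (by positivity)] at k2
    have hi2 : Integrable fun s => (s - M / ‖v‖) ^ 2 * exp (-w s) := by
      have h : Integrable fun s => s ^ 2 * exp (-w s) - 2 * (M / ‖v‖) * (s ^ 1 * exp (-w s)) +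
        (M / ‖v‖) ^ 2 * (s ^ 0 * exp (-w s)) :=
        ((hi 2).sub ((hi 1).const_mul _)).add ((hi 0).const_mul _)
      refine h.congr (ae_of_all _ fun s => ?_)
      ring
    have := (integral_pos_iff_support_of_nonneg (fun s => by positivity) hi2).2 (by
      have hs : (Function.support fun s => (s - M / ‖v‖) ^ 2 * exp (-w s)) = {M / ‖v‖}ᶜ := by
        ext s
        simp [sub_eq_zero, (exp_pos _).ne']
      rw [hs, measure_compl (measurableSet_singleton _) (by simp)]
      simp)
    exact this.ne' k2
  have key := abs_third_central_moment_le hw hi (μ := M / ‖v‖) (σ := √V / ‖v‖)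
    (by positivity) hm k0 k1 (by
      rw [div_pow, sq_sqrt hV, eq_comm, div_mul_eq_mul_div, div_eq_iff (by positivity), ← k2]
      ring)
  rw [hcomp', abs_mul, abs_of_nonneg (by positivity)]
  calc _ ≤ ‖v‖ ^ 3 * (2 * (√V / ‖v‖) ^ 3 * m) := by gcongr
    _ = 2 * √V ^ 3 * m := by field_simp
    _ = _ := by
      rw [sqrt_eq_rpow, ← rpow_natCast, ← rpow_mul hV]
      norm_num

lemma integrable_one_add_norm_pow_mul_exp_neg {d : ℕ} {r : ℝ} (hr : 0 < r) (k : ℕ) :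
    Integrable fun y : E d => (1 + ‖y‖) ^ k * exp (-(r * ‖y‖)) := by
  have h := (integrable_one_add_norm (E := E d) (μ := volume) (r := (d + 1 : ℕ))
    (by simp)).const_mul ((k + (d + 1)).factorial * (1 / r) ^ (k + (d + 1)) * exp r)
  refine h.mono' (by fun_prop) (ae_of_all _ fun y => ?_)
  have h1 := Real.pow_div_factorial_le_exp (r * (1 + ‖y‖)) (by positivity) (k + (d + 1))
  rw [div_le_iff₀ (by positivity)] at h1
  have e : (1 + ‖y‖) ^ (k + (d + 1)) =
      (1 / r) ^ (k + (d + 1)) * (r * (1 + ‖y‖)) ^ (k + (d + 1)) := by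
    rw [← mul_pow]; congr 1; field_simp
  rw [norm_of_nonneg (by positivity), rpow_neg (by positivity), rpow_natCast,
    ← div_eq_mul_inv, le_div_iff₀ (by positivity)]
  calc (1 + ‖y‖) ^ k * exp (-(r * ‖y‖)) * (1 + ‖y‖) ^ (d + 1)
      = (1 + ‖y‖) ^ (k + (d + 1)) * exp (-(r * ‖y‖)) := by ring
    _ ≤ (1 / r) ^ (k + (d + 1)) * (exp (r * (1 + ‖y‖)) * (k + (d + 1)).factorial) *
          exp (-(r * ‖y‖)) := by
        rw [e]; gcongr
    _ = (k + (d + 1)).factorial * (1 / r) ^ (k + (d + 1)) *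
          (exp (r * (1 + ‖y‖)) * exp (-(r * ‖y‖))) := by ring
    _ = _ := by
        rw [← exp_add]; ring_nf

section Laplace

variable {d : ℕ} {h : E d → ℝ} {V : Type} [NormedAddCommGroup V] [NormedSpace ℝ V]

lemma norm_exp_smul_le {φ : E d → V} {A r : ℝ} {k : ℕ}
    (hA : ∀ y, ‖φ y‖ ≤ A * (1 + ‖y‖) ^ k) {z y : E d} (hz : r * ‖y‖ ≤ h y - ⟪z, y⟫) :
    ‖exp (⟪z, y⟫ - h y) • φ y‖ ≤ A * ((1 + ‖y‖) ^ k * exp (-(r * ‖y‖))) := by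
  rw [norm_smul, norm_eq_abs, abs_exp]
  have h1 : exp (⟪z, y⟫ - h y) ≤ exp (-(r * ‖y‖)) := exp_le_exp.2 (by linarith)
  calc exp (⟪z, y⟫ - h y) * ‖φ y‖ ≤ exp (-(r * ‖y‖)) * (A * (1 + ‖y‖) ^ k) := by
        gcongr; exact hA y
    _ = _ := by ring

lemma integrable_exp_smul (hh : Continuous h) {φ : E d → V} (hφ : Continuous φ) {A r : ℝ}
    {k : ℕ} (hA : ∀ y, ‖φ y‖ ≤ A * (1 + ‖y‖) ^ k) (hr : 0 < r) {z : E d}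
    (hz : ∀ y, r * ‖y‖ ≤ h y - ⟪z, y⟫) :
    Integrable fun y => exp (⟪z, y⟫ - h y) • φ y :=
  ((integrable_one_add_norm_pow_mul_exp_neg hr k).const_mul A).mono' (by fun_prop)
    (ae_of_all _ fun y => norm_exp_smul_le hA (hz y))

lemma norm_innerSL_smulRight_le {φ : E d → V} {A : ℝ} {k : ℕ}
    (hA : ∀ y, ‖φ y‖ ≤ A * (1 + ‖y‖) ^ k) (y : E d) :
    ‖(innerSL ℝ y).smulRight (φ y)‖ ≤ A * (1 + ‖y‖) ^ (k + 1) := by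
  rw [ContinuousLinearMap.norm_smulRight_apply, innerSL_apply_norm]
  calc ‖y‖ * ‖φ y‖ ≤ (1 + ‖y‖) * (A * (1 + ‖y‖) ^ k) :=
        mul_le_mul (by linarith) (hA y) (norm_nonneg _) (by positivity)
    _ = _ := by ring

lemma continuous_innerSL_smulRight {φ : E d → V} (hφ : Continuous φ) :
    Continuous fun y => (innerSL ℝ y).smulRight (φ y) := by
  have := (ContinuousLinearMap.smulRightL ℝ (E d) V).continuous₂
  exact this.comp ((innerSL ℝ).continuous.prodMk hφ)

lemma hasFDerivAt_integral_exp_smul (hh : Continuous h) {φ : E d → V} (hφ : Continuous φ)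
    {A r : ℝ} {k : ℕ} (hA : ∀ y, ‖φ y‖ ≤ A * (1 + ‖y‖) ^ k) (hr : 0 < r) {x : E d}
    (hx : ∀ z ∈ Metric.ball x r, ∀ y, r * ‖y‖ ≤ h y - ⟪z, y⟫) :
    HasFDerivAt (fun z => ∫ y, exp (⟪z, y⟫ - h y) • φ y)
      (∫ y, exp (⟪x, y⟫ - h y) • (innerSL ℝ y).smulRight (φ y)) x := by
  have hc := continuous_innerSL_smulRight hφ
  refine hasFDerivAt_integral_of_dominated_of_fderiv_le (s := Metric.ball x r)
    (bound := fun y => A * ((1 + ‖y‖) ^ (k + 1) * exp (-(r * ‖y‖))))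
    (F' := fun z y => exp (⟪z, y⟫ - h y) • (innerSL ℝ y).smulRight (φ y))
    (Metric.ball_mem_nhds x hr)
    (Eventually.of_forall fun z => by fun_prop)
    (integrable_exp_smul hh hφ hA hr (hx x (Metric.mem_ball_self hr))) (by fun_prop)
    (ae_of_all _ fun y z hz => norm_exp_smul_le (norm_innerSL_smulRight_le hA) (hx z hz y))
    ((integrable_one_add_norm_pow_mul_exp_neg hr _).const_mul A)
    (ae_of_all _ fun y z _ => ?_)
  have h1 : HasFDerivAt (fun z : E d => ⟪z, y⟫ - h y) (innerSL ℝ y) z := by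
    have := ((innerSL ℝ y).hasFDerivAt (x := z)).sub_const (h y)
    refine this.congr_of_eventuallyEq (Eventually.of_forall fun w => ?_)
    simp [real_inner_comm]
  convert h1.exp.smul_const (φ y) using 1
  ext w
  simp [mul_smul]

lemma contDiffOn_integral_exp_smul (hh : Continuous h) {U : Set (E d)} (hU : IsOpen U)
    (hx : ∀ x ∈ U, ∃ r > 0, ∀ z ∈ Metric.ball x r, ∀ y, r * ‖y‖ ≤ h y - ⟪z, y⟫) (n : ℕ)
    {φ : E d → V} (hφ : Continuous φ) {A : ℝ} {k : ℕ} (hA : ∀ y, ‖φ y‖ ≤ A * (1 + ‖y‖) ^ k) :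
    ContDiffOn ℝ n (fun z => ∫ y, exp (⟪z, y⟫ - h y) • φ y) U := by
  induction n generalizing V k with
  | zero =>
    rw [Nat.cast_zero, contDiffOn_zero]
    intro x hxU
    obtain ⟨r, hr, hb⟩ := hx x hxU
    exact (hasFDerivAt_integral_exp_smul hh hφ hA hr hb).continuousAt.continuousWithinAt
  | succ n ih =>
    have hd : ∀ x ∈ U, HasFDerivAt (fun z => ∫ y, exp (⟪z, y⟫ - h y) • φ y)
        (∫ y, exp (⟪x, y⟫ - h y) • (innerSL ℝ y).smulRight (φ y)) x := fun x hxU => by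
      obtain ⟨r, hr, hb⟩ := hx x hxU
      exact hasFDerivAt_integral_exp_smul hh hφ hA hr hb
    rw [Nat.cast_add, Nat.cast_one, contDiffOn_succ_iff_fderiv_of_isOpen hU]
    refine ⟨fun x hxU => (hd x hxU).differentiableAt.differentiableWithinAt, by simp, ?_⟩
    exact (ih (continuous_innerSL_smulRight hφ) (norm_innerSL_smulRight_le hA)).congr
      fun x hxU => (hd x hxU).fderiv

end Laplace

lemma ContDiffOn.iteratedFDeriv_apply_eq_iteratedDeriv {F : Type*} [NormedAddCommGroup F]
    [NormedSpace ℝ F] {f : F → ℝ} {U : Set F} {n : ℕ} (hf : ContDiffOn ℝ n f U) (hU : IsOpen U)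
    {x : F} (hx : x ∈ U) (v : F) {k : ℕ} (hk : k ≤ n) :
    iteratedFDeriv ℝ k f x (fun _ => v) = iteratedDeriv k (fun t : ℝ => f (x + t • v)) 0 := by
  let g : ℝ →L[ℝ] F := ContinuousLinearMap.toSpanSingleton ℝ v
  have hU' : IsOpen ((fun z => x + z) ⁻¹' U) := hU.preimage (by fun_prop)
  have hf' : ContDiffOn ℝ n (fun z => f (x + z)) ((fun z => x + z) ⁻¹' U) :=
    hf.comp (by fun_prop) (fun z hz => hz)
  have hmem : g 0 ∈ (fun z => x + z) ⁻¹' U := by simpa [g] using hx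
  have hgU : IsOpen (g ⁻¹' ((fun z => x + z) ⁻¹' U)) := hU'.preimage g.continuous
  have key := g.iteratedFDerivWithin_comp_right hf' hU'.uniqueDiffOn hgU.uniqueDiffOn hmem
    (i := k) (by exact_mod_cast hk)
  rw [iteratedFDerivWithin_of_isOpen k hU' hmem, iteratedFDerivWithin_of_isOpen k hgU hmem,
    iteratedFDeriv_comp_add_left] at key
  rw [iteratedDeriv_eq_iteratedFDeriv]
  have := congrArg (fun L => L fun _ => (1 : ℝ)) key
  simp only [ContinuousMultilinearMap.compContinuousLinearMap_apply] at this
  have e : (fun t : ℝ => f (x + t • v)) = (fun z => f (x + z)) ∘ g := by ext t; simp [g]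
  rw [e, this]
  simp [g]

section Cgf

variable {Ω : Type*} [MeasurableSpace Ω] {X : Ω → ℝ} {μ : Measure Ω}

lemma iteratedDeriv_three_cgf_zero (h : 0 ∈ interior (integrableExpSet X μ)) (hμ : μ ≠ 0) :
    iteratedDeriv 3 (cgf X μ) 0 =
      (∫ ω, (X ω - deriv (cgf X μ) 0) ^ 3 ∂μ) / μ.real Set.univ := by
  have hm : 0 < mgf X μ 0 := mgf_pos' hμ (interior_subset (s := integrableExpSet X μ) h)
  have hm0 : mgf X μ 0 = μ.real Set.univ := by simp [mgf]
  have h0 := hasDerivAt_integral_pow_mul_exp_real h 0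
  have h1 := hasDerivAt_integral_pow_mul_exp_real h 1
  have h2 := hasDerivAt_integral_pow_mul_exp_real h 2
  simp only [pow_zero, one_mul, zero_add, pow_one, zero_mul, exp_zero, mul_one] at h0 h1 h2
  have hmg : HasDerivAt (mgf X μ) (∫ ω, X ω ∂μ) 0 := h0
  have hev : iteratedDeriv 2 (cgf X μ) =ᶠ[𝓝 0] fun t =>
      (∫ ω, X ω ^ 2 * exp (t * X ω) ∂μ) / mgf X μ t -
        ((∫ ω, X ω * exp (t * X ω) ∂μ) / mgf X μ t) ^ 2 := by
    filter_upwards [isOpen_interior.mem_nhds h] with t ht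
    rw [iteratedDeriv_two_cgf ht, deriv_cgf ht]
  have hd := (h2.div hmg hm.ne').sub ((h1.div hmg hm.ne').pow 2)
  rw [iteratedDeriv_succ, hev.deriv_eq]
  refine hd.deriv.trans ?_
  simp only [Pi.div_apply, zero_mul, exp_zero, mul_one]
  have i1 := integrable_pow_of_mem_interior_integrableExpSet h 1
  have i2 := integrable_pow_of_mem_interior_integrableExpSet h 2
  have i3 := integrable_pow_of_mem_interior_integrableExpSet h 3
  have i0 := integrable_pow_of_mem_interior_integrableExpSet h 0
  simp only [pow_zero, pow_one] at i0 i1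
  have : IsFiniteMeasure μ := by
    simpa [integrable_const_iff] using i0
  rw [deriv_cgf_zero h, ← hm0]
  set m0 := mgf X μ 0
  set M := (∫ ω, X ω ∂μ) / m0 with hM
  have e : ∫ ω, (X ω - M) ^ 3 ∂μ = (∫ ω, X ω ^ 3 ∂μ) - 3 * M * (∫ ω, X ω ^ 2 ∂μ) +
      3 * M ^ 2 * (∫ ω, X ω ∂μ) - M ^ 3 * m0 := by
    have a2 : Integrable (fun ω => 3 * M * X ω ^ 2) μ := i2.const_mul _
    have a1 : Integrable (fun ω => 3 * M ^ 2 * X ω) μ := i1.const_mul _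
    have a0 : Integrable (fun _ => M ^ 3) μ := integrable_const _
    have a32 : Integrable (fun ω => X ω ^ 3 - 3 * M * X ω ^ 2) μ := i3.sub a2
    have a321 : Integrable (fun ω => X ω ^ 3 - 3 * M * X ω ^ 2 + 3 * M ^ 2 * X ω) μ := a32.add a1
    rw [← integral_const_mul, ← integral_const_mul, ← integral_sub i3 a2, ← integral_add a32 a1,
      hm0, mul_comm (M ^ 3), ← smul_eq_mul (μ.real _), ← integral_const, ← integral_sub a321 a0]
    exact integral_congr_ae (ae_of_all _ fun ω => by ring)
  rw [e, hM]
  norm_num only [pow_one, Nat.cast_ofNat]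
  field_simp
  ring

lemma iteratedDeriv_two_cgf_nonneg {t : ℝ} (h : t ∈ interior (integrableExpSet X μ)) :
    0 ≤ iteratedDeriv 2 (cgf X μ) t := by
  rw [iteratedDeriv_two_cgf_eq_integral h]
  exact div_nonneg (integral_nonneg fun ω => by positivity) mgf_nonneg

end Cgf

section Homogeneous

variable {d : ℕ} {g : E d → ℝ}

lemma integrable_mul_exp_neg (hg : Continuous g) {r : ℝ} (hr : 0 < r)
    (hrg : ∀ y, r * ‖y‖ ≤ g y) {f : E d → ℝ} (hf : Continuous f) {A : ℝ} {k : ℕ}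
    (hA : ∀ y, |f y| ≤ A * (1 + ‖y‖) ^ k) : Integrable fun y => f y * exp (-g y) := by
  have := integrable_exp_smul hg hf hA hr (z := 0) (by simpa using hrg)
  simpa [mul_comm] using this

/-- Euler's identity for homogeneous functions, integrated against `exp (-g)`. -/
lemma integral_mul_exp_neg_of_homogeneous (hg : Continuous g) {r L : ℝ} (hr : 0 < r)
    (hrg : ∀ y, r * ‖y‖ ≤ g y) (hgL : ∀ y, g y ≤ L * (1 + ‖y‖))
    (hhom : ∀ s > 0, ∀ y, g (s • y) = s * g y)
    {f : E d → ℝ} (hf : Continuous f) {A : ℝ} {k : ℕ} (hA : ∀ y, |f y| ≤ A * (1 + ‖y‖) ^ k)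
    {j : ℕ} (hfhom : ∀ s > 0, ∀ y, f (s • y) = s ^ j * f y) :
    ∫ y, g y * f y * exp (-g y) = (d + j) * ∫ y, f y * exp (-g y) := by
  have hg0 : ∀ y, 0 ≤ g y := fun y => le_trans (by positivity) (hrg y)
  have hbd : ∀ y, |g y * f y| ≤ L * A * (1 + ‖y‖) ^ (k + 1) := by
    intro y
    rw [abs_mul, abs_of_nonneg (hg0 y)]
    calc g y * |f y| ≤ (L * (1 + ‖y‖)) * (A * (1 + ‖y‖) ^ k) :=
          mul_le_mul (hgL y) (hA y) (abs_nonneg _) ((hg0 y).trans (hgL y))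
      _ = _ := by ring
  let I : ℝ → ℝ := fun s => ∫ y, f y * exp (-(s * g y))
  have hI : HasDerivAt I (∫ y, -(g y * f y * exp (-(1 * g y)))) 1 := by
    refine (hasDerivAt_integral_of_dominated_loc_of_deriv_le (s := Set.Ioi (1 / 2))
      (F' := fun s y => -(g y * f y * exp (-(s * g y))))
      (bound := fun y => L * A * ((1 + ‖y‖) ^ (k + 1) * exp (-(r / 2 * ‖y‖))))
      (Ioi_mem_nhds (by norm_num)) (Eventually.of_forall fun s => by fun_prop) ?_
      (by fun_prop) (ae_of_all _ fun y s hs => ?_)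
      ((integrable_one_add_norm_pow_mul_exp_neg (half_pos hr) _).const_mul _)
      (ae_of_all _ fun y s _ => ?_)).2
    · simpa using integrable_mul_exp_neg hg hr hrg hf hA
    · have hs' : 1 / 2 < s := hs
      rw [norm_neg, norm_mul, norm_eq_abs, norm_eq_abs, abs_exp]
      have h1 : exp (-(s * g y)) ≤ exp (-(r / 2 * ‖y‖)) := by
        refine exp_le_exp.2 ?_
        nlinarith [hrg y, hg0 y]
      calc _ ≤ (L * A * (1 + ‖y‖) ^ (k + 1)) * exp (-(r / 2 * ‖y‖)) :=
            mul_le_mul (hbd y) h1 (exp_pos _).le ((abs_nonneg _).trans (hbd y))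
        _ = _ := by ring
    · have h1 : HasDerivAt (fun s => -(s * g y)) (-(1 * g y)) s :=
        ((hasDerivAt_id s).mul_const _).neg
      refine (h1.exp.const_mul (f y)).congr_deriv ?_
      ring
  have hscale : ∀ s > 0, s ^ (d + j) * I s = I 1 := by
    intro s hs
    have h1 := Measure.integral_comp_smul (volume : Measure (E d))
      (fun y => f y * exp (-g y)) s
    simp only [hfhom s hs, hhom s hs, finrank_euclideanSpace, Fintype.card_fin] at h1
    have h2 : ∫ y, s ^ j * f y * exp (-(s * g y)) = s ^ j * I s := by
      rw [← integral_const_mul]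
      exact integral_congr_ae (ae_of_all _ fun y => by ring)
    rw [h2, abs_of_pos (by positivity), smul_eq_mul, eq_inv_mul_iff_mul_eq₀ (by positivity)] at h1
    simp only [I, one_mul]
    rw [← h1]
    ring
  have hd : HasDerivAt (fun s => s ^ (d + j) * I s) 0 1 := by
    refine (hasDerivAt_const (1 : ℝ) (I 1)).congr_of_eventuallyEq ?_
    filter_upwards [Ioi_mem_nhds zero_lt_one] with s hs using hscale s hs
  have hd' := (hasDerivAt_pow (d + j) (1 : ℝ)).mul hI
  have := hd'.unique hd
  simp only [one_pow, mul_one, one_mul, integral_neg, I] at this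
  push_cast at this
  linarith

/-- Under the density `exp (-g)` with `g` positively homogeneous, the squared mean of a linear
functional is at most `d` times its variance. -/
lemma sq_mean_le_mul_variance (hg : Continuous g) {r L : ℝ} (hr : 0 < r)
    (hrg : ∀ y, r * ‖y‖ ≤ g y) (hgL : ∀ y, g y ≤ L * (1 + ‖y‖))
    (hhom : ∀ s > 0, ∀ y, g (s • y) = s * g y) (v : E d) {m M V : ℝ} (hm : 0 < m)
    (h0 : ∫ y, exp (-g y) = m) (h1 : ∫ y, ⟪v, y⟫ * exp (-g y) = M * m)
    (h2 : ∫ y, (⟪v, y⟫ - M) ^ 2 * exp (-g y) = V * m) : M ^ 2 ≤ d * V := by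
  obtain rfl | hd := Nat.eq_zero_or_pos d
  · have hv : v = 0 := Subsingleton.elim _ _
    simp only [hv, inner_zero_left, zero_mul, integral_zero] at h1
    have : M = 0 := by simpa [hm.ne'] using h1.symm
    simp [this]
  have hg0 : ∀ y, 0 ≤ g y := fun y => le_trans (by positivity) (hrg y)
  have hL : 0 ≤ L := by simpa using (hg0 0).trans (hgL 0)
  have b0 : ∀ y : E d, |(1 : ℝ)| ≤ 1 * (1 + ‖y‖) ^ 0 := by simp
  have bg : ∀ y, |g y| ≤ L * (1 + ‖y‖) ^ 1 := fun y => by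
    rw [abs_of_nonneg (hg0 y), pow_one]; exact hgL y
  have bX : ∀ y, |⟪v, y⟫| ≤ ‖v‖ * (1 + ‖y‖) ^ 1 := fun y => by
    rw [pow_one]
    refine (abs_real_inner_le_norm v y).trans ?_
    gcongr
    linarith
  have cX : Continuous fun y : E d => ⟪v, y⟫ := by fun_prop
  have e1 := integral_mul_exp_neg_of_homogeneous hg hr hrg hgL hhom continuous_const b0 (j := 0)
    (by simp)
  have e2 := integral_mul_exp_neg_of_homogeneous hg hr hrg hgL hhom hg bg (j := 1)
    (by simpa using hhom)
  have e3 := integral_mul_exp_neg_of_homogeneous hg hr hrg hgL hhom cX bX (j := 1)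
    (by simp [inner_smul_right])
  simp only [mul_one, one_mul, Nat.cast_zero, add_zero, Nat.cast_one, h0, h1] at e1 e2 e3
  rw [e1] at e2
  have bXX : ∀ y, |(⟪v, y⟫ - M) ^ 2| ≤ (‖v‖ + |M|) ^ 2 * (1 + ‖y‖) ^ 2 := fun y => by
    rw [abs_pow, ← mul_pow]
    gcongr
    have h3 := bX y
    rw [pow_one] at h3
    have h4 : |M| ≤ |M| * (1 + ‖y‖) := le_mul_of_one_le_right (abs_nonneg _) (by simp)
    linarith [abs_sub ⟪v, y⟫ M]
  have i0 : Integrable fun y => exp (-g y) := by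
    simpa using integrable_mul_exp_neg hg hr hrg continuous_const b0
  have ig := integrable_mul_exp_neg hg hr hrg hg bg
  have iX := integrable_mul_exp_neg hg hr hrg cX bX
  have iXX := integrable_mul_exp_neg hg hr hrg (by fun_prop) bXX
  have igg : Integrable fun y => g y * g y * exp (-g y) :=
    integrable_mul_exp_neg hg hr hrg (f := fun y => g y * g y) (by fun_prop) (A := L * L) (k := 2)
      fun y => by
        rw [abs_mul]
        calc |g y| * |g y| ≤ (L * (1 + ‖y‖) ^ 1) * (L * (1 + ‖y‖) ^ 1) := by
              gcongr <;> exact bg y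
          _ = _ := by ring
  have igX : Integrable fun y => g y * ⟪v, y⟫ * exp (-g y) :=
    integrable_mul_exp_neg hg hr hrg (f := fun y => g y * ⟪v, y⟫) (by fun_prop) (A := L * ‖v‖)
      (k := 2) fun y => by
        rw [abs_mul]
        calc |g y| * |⟪v, y⟫| ≤ (L * (1 + ‖y‖) ^ 1) * (‖v‖ * (1 + ‖y‖) ^ 1) := by
              gcongr
              exacts [bg y, bX y]
          _ = _ := by ring
  set c : ℝ := M / d with hc
  have hpos : 0 ≤ ∫ y, (⟪v, y⟫ - M - c * (g y - d)) ^ 2 * exp (-g y) :=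
    integral_nonneg fun y => by positivity
  have hexp : ∫ y, (⟪v, y⟫ - M - c * (g y - d)) ^ 2 * exp (-g y) =
      V * m - 2 * c * (M * m) + c ^ 2 * (d * m) := by
    have j1 : Integrable fun y => (⟪v, y⟫ - M) ^ 2 * exp (-g y)
        - 2 * c * (g y * ⟪v, y⟫ * exp (-g y)) := iXX.sub (igX.const_mul _)
    have j2 : Integrable fun y => (⟪v, y⟫ - M) ^ 2 * exp (-g y)
        - 2 * c * (g y * ⟪v, y⟫ * exp (-g y)) + 2 * c * d * (⟪v, y⟫ * exp (-g y)) :=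
      j1.add (iX.const_mul _)
    have j3 : Integrable fun y => (⟪v, y⟫ - M) ^ 2 * exp (-g y)
        - 2 * c * (g y * ⟪v, y⟫ * exp (-g y)) + 2 * c * d * (⟪v, y⟫ * exp (-g y))
        + c ^ 2 * (g y * g y * exp (-g y)) := j2.add (igg.const_mul _)
    have j4 : Integrable fun y => (⟪v, y⟫ - M) ^ 2 * exp (-g y)
        - 2 * c * (g y * ⟪v, y⟫ * exp (-g y)) + 2 * c * d * (⟪v, y⟫ * exp (-g y))
        + c ^ 2 * (g y * g y * exp (-g y)) + (2 * c * M - 2 * c ^ 2 * d) * (g y * exp (-g y)) :=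
      j3.add (ig.const_mul _)
    calc _ = ∫ y, ((⟪v, y⟫ - M) ^ 2 * exp (-g y)
        - 2 * c * (g y * ⟪v, y⟫ * exp (-g y)) + 2 * c * d * (⟪v, y⟫ * exp (-g y))
        + c ^ 2 * (g y * g y * exp (-g y)) + (2 * c * M - 2 * c ^ 2 * d) * (g y * exp (-g y))
        + (c ^ 2 * d ^ 2 - 2 * c * M * d) * exp (-g y)) :=
          integral_congr_ae (ae_of_all _ fun y => by ring)
      _ = _ := by
          rw [integral_add j4 (i0.const_mul _), integral_add j3 (ig.const_mul _),
            integral_add j2 (igg.const_mul _), integral_add j1 (iX.const_mul _),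
            integral_sub iXX (igX.const_mul _)]
          simp only [integral_const_mul]
          rw [h2, e3, h1, e2, e1, h0]
          ring
  rw [hexp] at hpos
  have hd' : (0 : ℝ) < d := by exact_mod_cast hd
  have hfin : 0 ≤ (V - M ^ 2 / d) * m := by
    have : V * m - 2 * c * (M * m) + c ^ 2 * (d * m) = (V - M ^ 2 / d) * m := by
      rw [hc]; field_simp; ring
    rwa [this] at hpos
  have := nonneg_of_mul_nonneg_left hfin hm
  rw [sub_nonneg, div_le_iff₀ hd'] at this
  linarith

end Homogeneous

/-- A continuous function that does not increase under some translation, strictly somewhere,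
makes `exp (-g)` non-integrable. -/
lemma lintegral_exp_neg_eq_top {d : ℕ} {g : E d → ℝ} (hg : Continuous g) {u y₀ : E d}
    (hu : ∀ y, g (y + u) ≤ g y) (hlt : g (y₀ + u) < g y₀) :
    ∫⁻ y, ENNReal.ofReal (exp (-g y)) = ⊤ := by
  by_contra hfin
  have hle : (fun y => ENNReal.ofReal (exp (-g y))) ≤ᵐ[volume]
      fun y => ENNReal.ofReal (exp (-g (y + u))) :=
    ae_of_all _ fun y => ENNReal.ofReal_le_ofReal (exp_le_exp.2 (neg_le_neg (hu y)))
  have hae := ae_eq_of_ae_le_of_lintegral_le hle hfin (by fun_prop)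
    (lintegral_add_right_eq_self (fun y => ENNReal.ofReal (exp (-g y))) u).le
  have heq := (Continuous.ae_eq_iff_eq volume (ENNReal.continuous_ofReal.comp (by fun_prop))
    (ENNReal.continuous_ofReal.comp (by fun_prop))).1 hae
  have h := congrFun heq y₀
  rw [Function.comp_apply, Function.comp_apply,
    ENNReal.ofReal_eq_ofReal_iff (exp_pos _).le (exp_pos _).le, exp_eq_exp] at h
  linarith

/-- The support function of a set. -/
def supportFun {d : ℕ} (K : Set (E d)) (y : E d) : ℝ := sSup ((fun k => ⟪k, y⟫) '' K)

section SupportFun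

variable {d : ℕ} {K : Set (E d)}

lemma inner_le_supportFun (hK : IsCompact K) {k : E d} (hk : k ∈ K) (y : E d) :
    ⟪k, y⟫ ≤ supportFun K y :=
  le_csSup (hK.image (by fun_prop)).bddAbove (Set.mem_image_of_mem _ hk)

lemma exists_supportFun_eq (hK : IsCompact K) (hne : K.Nonempty) (y : E d) :
    ∃ k ∈ K, supportFun K y = ⟪k, y⟫ :=
  hK.exists_sSup_image_eq hne (by fun_prop)

lemma continuous_supportFun (hK : IsCompact K) : Continuous (supportFun K) :=
  hK.continuous_sSup (f := fun y k => ⟪k, y⟫) (by fun_prop)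

lemma supportFun_add_le (hK : IsCompact K) (hne : K.Nonempty) (y z : E d) :
    supportFun K (y + z) ≤ supportFun K y + supportFun K z := by
  obtain ⟨k, hk, h⟩ := exists_supportFun_eq hK hne (y + z)
  rw [h, inner_add_right]
  exact add_le_add (inner_le_supportFun hK hk y) (inner_le_supportFun hK hk z)

lemma supportFun_smul (hK : IsCompact K) (hne : K.Nonempty) {s : ℝ} (hs : 0 ≤ s) (y : E d) :
    supportFun K (s • y) = s * supportFun K y := by
  obtain ⟨k, hk, h⟩ := exists_supportFun_eq hK hne (s • y)
  obtain ⟨k', hk', h'⟩ := exists_supportFun_eq hK hne y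
  refine le_antisymm ?_ ?_
  · rw [h, inner_smul_right]
    exact mul_le_mul_of_nonneg_left (inner_le_supportFun hK hk y) hs
  · rw [h', ← inner_smul_right]
    exact inner_le_supportFun hK hk' _

lemma convexOn_supportFun_sub_inner (hK : IsCompact K) (hne : K.Nonempty) (x : E d) :
    ConvexOn ℝ Set.univ fun y => supportFun K y - ⟪x, y⟫ := by
  refine ⟨convex_univ, fun y _ z _ a b ha hb _ => ?_⟩
  have := supportFun_add_le hK hne (a • y) (b • z)
  rw [supportFun_smul hK hne ha, supportFun_smul hK hne hb] at this
  simp only [inner_add_right, inner_smul_right, smul_eq_mul]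
  linarith

lemma exists_supportFun_le (hK : IsCompact K) (hne : K.Nonempty) :
    ∃ M : ℝ, 0 ≤ M ∧ ∀ y, supportFun K y ≤ M * ‖y‖ := by
  obtain ⟨M, hM⟩ := hK.isBounded.exists_norm_le
  refine ⟨M, (norm_nonneg _).trans (hM _ hne.some_mem), fun y => ?_⟩
  obtain ⟨k, hk, h⟩ := exists_supportFun_eq hK hne y
  rw [h]
  exact (real_inner_le_norm k y).trans (mul_le_mul_of_nonneg_right (hM k hk) (norm_nonneg _))

lemma exists_le_supportFun_sub_inner (hK : IsCompact K) {x : E d} (hx : x ∈ interior K) :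
    ∃ r > 0, ∀ z ∈ Metric.ball x r, ∀ y, r * ‖y‖ ≤ supportFun K y - ⟪z, y⟫ := by
  obtain ⟨ε, hε, hb⟩ := Metric.isOpen_iff.1 isOpen_interior x hx
  refine ⟨ε / 2, half_pos hε, fun z hz y => ?_⟩
  rcases eq_or_ne y 0 with rfl | hy
  · have := inner_le_supportFun hK (interior_subset hx) 0
    simpa using this
  have hy' : 0 < ‖y‖ := norm_pos_iff.2 hy
  have hmem : z + (ε / 2 * ‖y‖⁻¹) • y ∈ K := by
    refine interior_subset (hb ?_)
    rw [Metric.mem_ball, dist_eq_norm] at hz ⊢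
    calc ‖z + (ε / 2 * ‖y‖⁻¹) • y - x‖ = ‖(z - x) + (ε / 2 * ‖y‖⁻¹) • y‖ := by congr 1; abel
      _ ≤ ‖z - x‖ + ‖(ε / 2 * ‖y‖⁻¹) • y‖ := norm_add_le _ _
      _ = ‖z - x‖ + ε / 2 := by
          rw [norm_smul, norm_of_nonneg (by positivity)]
          field_simp
      _ < ε := by linarith
  have h := inner_le_supportFun hK hmem y
  rw [inner_add_left, real_inner_smul_left, real_inner_self_eq_norm_sq] at h
  have e : ε / 2 * ‖y‖⁻¹ * ‖y‖ ^ 2 = ε / 2 * ‖y‖ := by field_simp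
  linarith

lemma lintegral_exp_inner_sub_supportFun_eq_top (hKconv : Convex ℝ K) (hK : IsCompact K)
    (hKint : (interior K).Nonempty) {p : E d} (hp : p ∈ frontier K) :
    ∫⁻ y, ENNReal.ofReal (exp (⟪p, y⟫ - supportFun K y)) = ⊤ := by
  have hne : K.Nonempty := hKint.mono interior_subset
  obtain ⟨f, hf⟩ := geometric_hahn_banach_open_point hKconv.interior isOpen_interior hp.2
  obtain ⟨u, rfl⟩ := (InnerProductSpace.toDual ℝ (E d)).surjective f
  simp only [InnerProductSpace.toDual_apply_apply] at hf
  have hle : ∀ k ∈ K, ⟪k, u⟫ ≤ ⟪p, u⟫ := by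
    intro k hk
    have hcl : k ∈ closure (interior K) := by
      rw [hKconv.closure_interior_eq_closure_of_nonempty_interior hKint]
      exact subset_closure hk
    have hclosed : IsClosed {k : E d | ⟪k, u⟫ ≤ ⟪p, u⟫} :=
      isClosed_le (by fun_prop) continuous_const
    refine closure_minimal (fun z hz => ?_) hclosed hcl
    have := (hf z hz).le
    rwa [real_inner_comm, real_inner_comm p] at this
  have hpu : supportFun K u ≤ ⟪p, u⟫ := by
    obtain ⟨k, hk, h⟩ := exists_supportFun_eq hK hne u
    rw [h]
    exact hle k hk
  obtain ⟨k, hk⟩ := hKint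
  have hhc := continuous_supportFun hK
  have := lintegral_exp_neg_eq_top (g := fun y => supportFun K y - ⟪p, y⟫) (u := u) (y₀ := -u)
    (by fun_prop) (fun y => by
      have := supportFun_add_le hK hne y u
      rw [inner_add_right]
      linarith) (by
      have h1 := inner_le_supportFun hK (interior_subset hk) (-u)
      have h2 := hf k hk
      have h3 := supportFun_smul hK hne le_rfl (0 : E d)
      rw [zero_smul, zero_mul] at h3
      rw [inner_neg_right] at h1
      rw [real_inner_comm, real_inner_comm p] at h2
      simp only [neg_add_cancel, h3, inner_zero_right, inner_neg_right]
      linarith)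
  simpa only [neg_sub] using this

end SupportFun

/-- The logarithm of the Laplace transform of `exp (-h)`, where `h` is the support function
of `K`. -/
def logLaplace {d : ℕ} (K : Set (E d)) (x : E d) : ℝ :=
  log (∫ y, exp (⟪x, y⟫ - supportFun K y))

/-- The measure with density `exp (⟪x, y⟫ - h y)`, where `h` is the support function of `K`. -/
def tiltedMeasure {d : ℕ} (K : Set (E d)) (x : E d) : Measure (E d) :=
  volume.withDensity fun y => ENNReal.ofReal (exp (-(supportFun K y - ⟪x, y⟫)))

section LogLaplace

variable {d : ℕ} {K : Set (E d)}

lemma integral_tiltedMeasure (hK : IsCompact K) (x : E d) (f : E d → ℝ) :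
    ∫ y, f y ∂(tiltedMeasure K x) = ∫ y, f y * exp (-(supportFun K y - ⟪x, y⟫)) := by
  have hhc := continuous_supportFun hK
  rw [tiltedMeasure, integral_withDensity_eq_integral_toReal_smul (by fun_prop) (by simp)]
  exact integral_congr_ae (ae_of_all _ fun s => by
    simp [ENNReal.toReal_ofReal (exp_pos _).le, mul_comm])

lemma integrable_exp_inner_sub_supportFun (hK : IsCompact K) {x : E d} (hx : x ∈ interior K) :
    Integrable fun y => exp (⟪x, y⟫ - supportFun K y) := by
  obtain ⟨r, hr, hb⟩ := exists_le_supportFun_sub_inner hK hx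
  have := integrable_exp_smul (continuous_supportFun hK) (φ := fun _ => (1 : ℝ))
    continuous_const (A := 1) (k := 0) (by simp) hr (hb x (Metric.mem_ball_self hr))
  simpa using this

lemma integral_exp_inner_sub_supportFun_pos (hK : IsCompact K) {x : E d} (hx : x ∈ interior K) :
    0 < ∫ y, exp (⟪x, y⟫ - supportFun K y) :=
  integral_exp_pos (integrable_exp_inner_sub_supportFun hK hx)

lemma mgf_tiltedMeasure (hK : IsCompact K) (x v : E d) (t : ℝ) :
    mgf (fun y => ⟪v, y⟫) (tiltedMeasure K x) t =
      ∫ y, exp (⟪x + t • v, y⟫ - supportFun K y) := by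
  rw [mgf, integral_tiltedMeasure hK]
  refine integral_congr_ae (ae_of_all _ fun y => ?_)
  simp only
  rw [← exp_add, inner_add_left, real_inner_smul_left]
  ring_nf

lemma cgf_tiltedMeasure (hK : IsCompact K) (x v : E d) :
    cgf (fun y => ⟪v, y⟫) (tiltedMeasure K x) = fun t => logLaplace K (x + t • v) := by
  ext t
  rw [cgf, mgf_tiltedMeasure hK, logLaplace]

lemma mem_interior_integrableExpSet_tiltedMeasure (hK : IsCompact K) {x v : E d} {t : ℝ}
    (ht : x + t • v ∈ interior K) :
    t ∈ interior (integrableExpSet (fun y => ⟪v, y⟫) (tiltedMeasure K x)) := by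
  have hopen : IsOpen ((fun t : ℝ => x + t • v) ⁻¹' interior K) :=
    isOpen_interior.preimage (by fun_prop)
  refine interior_maximal (fun s hs => ?_) hopen ht
  have hhc := continuous_supportFun hK
  change Integrable _ _
  rw [tiltedMeasure, integrable_withDensity_iff_integrable_smul' (by fun_prop) (by simp)]
  refine (integrable_exp_inner_sub_supportFun hK hs).congr (ae_of_all _ fun y => ?_)
  simp only
  rw [ENNReal.toReal_ofReal (exp_pos _).le, smul_eq_mul, ← exp_add, inner_add_left,
    real_inner_smul_left]
  ring_nf

lemma zero_mem_interior_integrableExpSet_tiltedMeasure (hK : IsCompact K) {x : E d}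
    (hx : x ∈ interior K) (v : E d) :
    0 ∈ interior (integrableExpSet (fun y => ⟪v, y⟫) (tiltedMeasure K x)) :=
  mem_interior_integrableExpSet_tiltedMeasure hK (by simpa using hx)

lemma contDiffOn_logLaplace (hK : IsCompact K) : ContDiffOn ℝ 3 (logLaplace K) (interior K) := by
  have h := contDiffOn_integral_exp_smul (continuous_supportFun hK) isOpen_interior
    (fun x hx => exists_le_supportFun_sub_inner hK hx) 3 (φ := fun _ => (1 : ℝ))
    continuous_const (A := 1) (k := 0) (by simp)
  simp only [smul_eq_mul, mul_one] at h
  exact h.log fun x hx => (integral_exp_inner_sub_supportFun_pos hK hx).ne'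

lemma iteratedFDeriv_logLaplace (hK : IsCompact K) {x : E d} (hx : x ∈ interior K) (v : E d)
    {k : ℕ} (hk : k ≤ 3) :
    iteratedFDeriv ℝ k (logLaplace K) x (fun _ => v) =
      iteratedDeriv k (cgf (fun y => ⟪v, y⟫) (tiltedMeasure K x)) 0 := by
  rw [cgf_tiltedMeasure hK]
  exact (contDiffOn_logLaplace hK).iteratedFDeriv_apply_eq_iteratedDeriv (n := 3)
    isOpen_interior hx v hk

lemma convexOn_logLaplace (hKconv : Convex ℝ K) (hK : IsCompact K) :
    ConvexOn ℝ (interior K) (logLaplace K) := by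
  refine ⟨hKconv.interior, fun x hx z hz a b ha hb hab => ?_⟩
  set X : E d → ℝ := fun y => ⟪z - x, y⟫ with hX
  set S := interior (integrableExpSet X (tiltedMeasure K x))
  have h0 : (0 : ℝ) ∈ S := zero_mem_interior_integrableExpSet_tiltedMeasure hK hx _
  have h1 : (1 : ℝ) ∈ S := mem_interior_integrableExpSet_tiltedMeasure hK (by simpa using hz)
  have hconv : ConvexOn ℝ S (cgf X (tiltedMeasure K x)) := by
    refine convexOn_of_deriv2_nonneg' convex_integrableExpSet.interior
      (fun t ht => (analyticAt_cgf ht).differentiableAt.differentiableWithinAt)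
      (fun t ht => (analyticAt_cgf ht).deriv.differentiableAt.differentiableWithinAt)
      fun t ht => ?_
    rw [← iteratedDeriv_eq_iterate]
    exact iteratedDeriv_two_cgf_nonneg ht
  have := hconv.2 h0 h1 ha hb hab
  rw [cgf_tiltedMeasure hK] at this
  simp only [mul_zero, smul_eq_mul, mul_one, zero_add, zero_smul, add_zero, one_smul,
    add_sub_cancel] at this
  have e : a • x + b • z = x + b • (z - x) := by
    obtain rfl : a = 1 - b := by linarith
    module
  rw [e]
  exact this

lemma tendsto_logLaplace_atTop (hKconv : Convex ℝ K) (hK : IsCompact K)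
    (hKint : (interior K).Nonempty) {x : ℕ → E d} {p : E d} (hx : ∀ n, x n ∈ interior K)
    (hxp : Tendsto x atTop (𝓝 p)) (hp : p ∈ frontier K) :
    Tendsto (fun n => logLaplace K (x n)) atTop atTop := by
  have hhc := continuous_supportFun hK
  refine tendsto_log_atTop.comp (ENNReal.tendsto_ofReal_nhds_top.1 ?_)
  have e : ∀ n, ENNReal.ofReal (∫ y, exp (⟪x n, y⟫ - supportFun K y)) =
      ∫⁻ y, ENNReal.ofReal (exp (⟪x n, y⟫ - supportFun K y)) := fun n =>
    ofReal_integral_eq_lintegral_ofReal (integrable_exp_inner_sub_supportFun hK (hx n))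
      (ae_of_all _ fun y => (exp_pos _).le)
  simp only [e]
  refine tendsto_of_le_liminf_of_limsup_le ?_ le_top
  rw [← lintegral_exp_inner_sub_supportFun_eq_top hKconv hK hKint hp]
  refine le_trans (lintegral_mono fun y => ?_) (lintegral_liminf_le fun n => by fun_prop)
  have ht : Tendsto (fun n => ENNReal.ofReal (exp (⟪x n, y⟫ - supportFun K y))) atTop
      (𝓝 (ENNReal.ofReal (exp (⟪p, y⟫ - supportFun K y)))) := by
    have hc : Continuous fun z : E d => ENNReal.ofReal (exp (⟪z, y⟫ - supportFun K y)) :=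
      ENNReal.continuous_ofReal.comp (by fun_prop)
    exact (hc.tendsto p).comp hxp
  exact ht.liminf_eq.ge

/-- The moments of a linear functional under the tilted measure, in terms of the derivatives of
its cumulant generating function. -/
lemma moments_tiltedMeasure (hK : IsCompact K) {x : E d} (hx : x ∈ interior K) (v : E d) :
    ∃ m M V : ℝ, 0 < m ∧ 0 ≤ V ∧ ∫ y, exp (-(supportFun K y - ⟪x, y⟫)) = m ∧
      (∫ y, ⟪v, y⟫ * exp (-(supportFun K y - ⟪x, y⟫)) = M * m) ∧
      (∫ y, (⟪v, y⟫ - M) * exp (-(supportFun K y - ⟪x, y⟫)) = 0) ∧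
      (∫ y, (⟪v, y⟫ - M) ^ 2 * exp (-(supportFun K y - ⟪x, y⟫)) = V * m) ∧
      deriv (cgf (fun y => ⟪v, y⟫) (tiltedMeasure K x)) 0 = M ∧
      iteratedDeriv 2 (cgf (fun y => ⟪v, y⟫) (tiltedMeasure K x)) 0 = V ∧
      iteratedDeriv 3 (cgf (fun y => ⟪v, y⟫) (tiltedMeasure K x)) 0 =
        (∫ y, (⟪v, y⟫ - M) ^ 3 * exp (-(supportFun K y - ⟪x, y⟫))) / m := by
  set X : E d → ℝ := fun y => ⟪v, y⟫ with hX
  set μ := tiltedMeasure K x with hμ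
  have h0 : 0 ∈ interior (integrableExpSet X μ) :=
    zero_mem_interior_integrableExpSet_tiltedMeasure hK hx v
  have hm1 : μ.real Set.univ = ∫ y, exp (-(supportFun K y - ⟪x, y⟫)) := by
    have := integral_tiltedMeasure hK x (fun _ => 1)
    simpa using this
  have hm : 0 < μ.real Set.univ := by
    rw [hm1]
    simpa only [neg_sub] using integral_exp_inner_sub_supportFun_pos hK hx
  have hμ0 : μ ≠ 0 := by
    intro h
    simp [h] at hm
  have hfin : IsFiniteMeasure μ := by
    have i0 := integrable_pow_of_mem_interior_integrableExpSet h0 0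
    simpa [integrable_const_iff] using i0
  have hiX : Integrable X μ := by
    simpa using integrable_pow_of_mem_interior_integrableExpSet h0 1
  have hM := deriv_cgf_zero h0
  have hV := iteratedDeriv_two_cgf_eq_integral h0
  have h3 := iteratedDeriv_three_cgf_zero h0 hμ0
  have hV0 := iteratedDeriv_two_cgf_nonneg h0
  simp only [zero_mul, exp_zero, mul_one, mgf_zero'] at hV
  set M := deriv (cgf X μ) 0
  have hXM : ∫ y, X y ∂μ = M * μ.real Set.univ := by rw [hM]; field_simp
  refine ⟨μ.real Set.univ, M, _, hm, hV0, hm1.symm, ?_, ?_, ?_, rfl, rfl, ?_⟩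
  · rw [← hXM, integral_tiltedMeasure hK]
  · rw [← integral_tiltedMeasure hK x (fun y => ⟪v, y⟫ - M)]
    have : ∫ y, (X y - M) ∂μ = 0 := by
      rw [integral_sub hiX (integrable_const _), hXM, integral_const, smul_eq_mul]
      ring
    exact this
  · rw [← integral_tiltedMeasure hK x (fun y => (⟪v, y⟫ - M) ^ 2), hV]
    field_simp
    rfl
  · rw [h3, ← integral_tiltedMeasure hK x (fun y => (⟪v, y⟫ - M) ^ 3)]

end LogLaplace

/-- existence of barriers. Every convex body `K ⊂ ℝ^d` admits a
`d`-self-concordant barrier. -/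
theorem statement3 {d : ℕ} (K : Set (E d)) (hKconv : Convex ℝ K)
    (hKcomp : IsCompact K) (hKint : (interior K).Nonempty) :
    ∃ R : E d → ℝ, IsSelfConcordantBarrier K (d : ℝ) R := by
  have hne : K.Nonempty := hKint.mono interior_subset
  have hhc := continuous_supportFun hKcomp
  have hess : ∀ x ∈ interior K, ∀ v, hessQF (logLaplace K) x v =
      iteratedDeriv 2 (cgf (fun y => ⟪v, y⟫) (tiltedMeasure K x)) 0 := fun x hx v => by
    rw [hessQF, ← iteratedFDeriv_logLaplace hKcomp hx v (by norm_num)]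
    congr 1
    ext i
    fin_cases i <;> rfl
  refine ⟨logLaplace K, ⟨contDiffOn_logLaplace hKcomp, convexOn_logLaplace hKconv hKcomp,
    fun x p hx hxp hp => tendsto_logLaplace_atTop hKconv hKcomp hKint hx hxp hp,
    fun x hx v => ?_⟩, fun x hx v => ?_⟩
  · obtain ⟨m, M, V, hm, hV, h0, -, h1, h2, -, k2, k3⟩ := moments_tiltedMeasure hKcomp hx v
    obtain ⟨r, hr, hb⟩ := exists_le_supportFun_sub_inner hKcomp hx
    have key := abs_third_moment_inner_le (convexOn_supportFun_sub_inner hKcomp hne x)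
      (by fun_prop) hr (C := 0) (by simpa using hb x (Metric.mem_ball_self hr)) hm hV h0 h1 h2
    have e : iteratedFDeriv ℝ 3 (logLaplace K) x ![v, v, v] =
        iteratedFDeriv ℝ 3 (logLaplace K) x (fun _ => v) := by
      congr 1
      ext i
      fin_cases i <;> rfl
    rw [e, iteratedFDeriv_logLaplace hKcomp hx v le_rfl, hess x hx, k2, k3, abs_div,
      abs_of_pos hm, div_le_iff₀ hm]
    exact key
  · obtain ⟨m, M, V, hm, hV, h0, h1, -, h2, k1, k2, -⟩ := moments_tiltedMeasure hKcomp hx v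
    obtain ⟨r, hr, hb⟩ := exists_le_supportFun_sub_inner hKcomp hx
    obtain ⟨B, hB, hBb⟩ := exists_supportFun_le hKcomp hne
    have key := sq_mean_le_mul_variance (g := fun y => supportFun K y - ⟪x, y⟫) (by fun_prop) hr
      (hb x (Metric.mem_ball_self hr)) (L := B + ‖x‖) (fun y => by
        have h3 := hBb y
        have h4 := abs_le.1 (abs_real_inner_le_norm x y)
        nlinarith [norm_nonneg x]) (fun s hs y => by
        rw [supportFun_smul hKcomp hne hs.le, inner_smul_right]
        ring) v hm h0 h1 h2
    have e : fderiv ℝ (logLaplace K) x v =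
        deriv (cgf (fun y => ⟪v, y⟫) (tiltedMeasure K x)) 0 := by
      have := iteratedFDeriv_logLaplace hKcomp hx v (k := 1) (by norm_num)
      rwa [iteratedFDeriv_one_apply, iteratedDeriv_one] at this
    rw [e, hess x hx, k1, k2]
    exact abs_le_sqrt key
end
end

section
/- The function f is nonnegative on ℝ, ∫_ℝ f(s) ds = 1, and for every t ∈ ℝ with t ≠ 0, ∫_{−∞}^t f(s) ds = 1/2 + (√(1+t²) − 1)/(2t). -/
noncomputable section
open MeasureTheory Real

/-- The one-dimensional density `f(s) = (√(1+s²) − 1)/(2 s² √(1+s²))` (with `f(0) = 1/4`). -/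
def fhyp (s : ℝ) : ℝ :=
  if s = 0 then 1/4 else (Real.sqrt (1 + s^2) - 1) / (2 * s^2 * Real.sqrt (1 + s^2))

theorem fhyp_eq_inv (s : ℝ) :
    fhyp s = (2 * √(1 + s ^ 2) * (1 + √(1 + s ^ 2)))⁻¹ := by
  unfold fhyp
  split_ifs with h
  · subst h
    norm_num
  · have hw : 0 < √(1 + s ^ 2) := Real.sqrt_pos.2 (by positivity)
    have hsq : √(1 + s ^ 2) ^ 2 = 1 + s ^ 2 := Real.sq_sqrt (by positivity)
    field_simp
    linear_combination hsq

theorem fhyp_nonneg (s : ℝ) : 0 ≤ fhyp s := by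
  rw [fhyp_eq_inv]
  positivity

theorem integrable_fhyp : Integrable fhyp := by
  have hcont : Continuous fhyp := by
    rw [funext fhyp_eq_inv]
    refine Continuous.inv₀ (by fun_prop) fun s => ?_
    have hw : 0 < √(1 + s ^ 2) := Real.sqrt_pos.2 (by positivity)
    positivity
  refine integrable_inv_one_add_sq.mono' hcont.aestronglyMeasurable (ae_of_all _ fun s => ?_)
  rw [Real.norm_of_nonneg (fhyp_nonneg s), fhyp_eq_inv]
  have hsq : √(1 + s ^ 2) ^ 2 = 1 + s ^ 2 := Real.sq_sqrt (by positivity)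
  have hw : 0 ≤ √(1 + s ^ 2) := Real.sqrt_nonneg _
  apply inv_anti₀ (by positivity)
  nlinarith

/-- The odd primitive of `fhyp`. -/
def fhypPrimitive (t : ℝ) : ℝ :=
  t / (2 * (1 + √(1 + t ^ 2)))

theorem fhypPrimitive_eq {t : ℝ} (ht : t ≠ 0) :
    fhypPrimitive t = (√(1 + t ^ 2) - 1) / (2 * t) := by
  have hw : 0 ≤ √(1 + t ^ 2) := Real.sqrt_nonneg _
  have hsq : √(1 + t ^ 2) ^ 2 = 1 + t ^ 2 := Real.sq_sqrt (by positivity)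
  unfold fhypPrimitive
  rw [div_eq_div_iff (by positivity) (by positivity)]
  linear_combination -2 * hsq

theorem fhypPrimitive_neg (t : ℝ) : fhypPrimitive (-t) = -fhypPrimitive t := by
  simp [fhypPrimitive, neg_div]

theorem hasDerivAt_fhypPrimitive (t : ℝ) : HasDerivAt fhypPrimitive (fhyp t) t := by
  have hw : 0 < √(1 + t ^ 2) := Real.sqrt_pos.2 (by positivity)
  have hsq : √(1 + t ^ 2) ^ 2 = 1 + t ^ 2 := Real.sq_sqrt (by positivity)
  have hsqrt : HasDerivAt (fun x : ℝ => √(1 + x ^ 2)) (t / √(1 + t ^ 2)) t := by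
    refine (((hasDerivAt_pow 2 t).const_add 1).sqrt (by positivity)).congr_deriv ?_
    field_simp
    norm_num
  refine ((hasDerivAt_id t).div ((hsqrt.const_add 1).const_mul 2)
    (by positivity)).congr_deriv ?_
  rw [fhyp_eq_inv]
  simp only [id]
  field_simp
  linear_combination hsq

open Filter Topology in
theorem tendsto_fhypPrimitive_atTop : Tendsto fhypPrimitive atTop (𝓝 (1 / 2)) := by
  have hlim : Tendsto (fun t : ℝ => 1 / 2 - (1 + t)⁻¹) atTop (𝓝 (1 / 2)) := by
    simpa using tendsto_const_nhds.sub
      (tendsto_inv_atTop_zero.comp (tendsto_atTop_add_const_left atTop (1 : ℝ) tendsto_id))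
  refine tendsto_of_tendsto_of_tendsto_of_le_of_le' hlim tendsto_const_nhds ?_ ?_
  · filter_upwards [eventually_ge_atTop 0] with t ht
    have hle : t ≤ √(1 + t ^ 2) := Real.le_sqrt_of_sq_le (by linarith)
    have hge : √(1 + t ^ 2) ≤ 1 + t := Real.sqrt_le_iff.2 ⟨by positivity, by nlinarith⟩
    have hw : 0 ≤ √(1 + t ^ 2) := Real.sqrt_nonneg _
    have hsub : fhypPrimitive t = 1 / 2 - (1 + √(1 + t ^ 2) - t) / (2 * (1 + √(1 + t ^ 2))) := by
      unfold fhypPrimitive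
      field_simp
      ring
    rw [hsub, inv_eq_one_div]
    gcongr 1 / 2 - ?_
    rw [div_le_div_iff₀ (by positivity) (by positivity)]
    nlinarith
  · refine .of_forall fun t => ?_
    have hle : t ≤ √(1 + t ^ 2) := Real.le_sqrt_of_sq_le (by linarith)
    have hw : 0 ≤ √(1 + t ^ 2) := Real.sqrt_nonneg _
    unfold fhypPrimitive
    rw [div_le_div_iff₀ (by positivity) (by positivity)]
    linarith

open Filter Topology in
theorem tendsto_fhypPrimitive_atBot : Tendsto fhypPrimitive atBot (𝓝 (-(1 / 2))) := by
  have h := (tendsto_fhypPrimitive_atTop.comp tendsto_neg_atBot_atTop).neg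
  simpa only [Function.comp_def, fhypPrimitive_neg, neg_neg] using h

/-- The function `fhyp` is nonnegative, integrates to `1` over `ℝ`, and its
cumulative distribution function is `t ↦ 1/2 + (√(1+t²) − 1)/(2t)` for `t ≠ 0`. -/
theorem statement9 :
    (∀ s : ℝ, 0 ≤ fhyp s) ∧
    (∫ s : ℝ, fhyp s) = 1 ∧
    ∀ t : ℝ, t ≠ 0 →
      (∫ s in Set.Iic t, fhyp s) = 1/2 + (Real.sqrt (1 + t^2) - 1) / (2 * t) := by
  refine ⟨fhyp_nonneg, ?_, fun t ht => ?_⟩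
  · rw [integral_of_hasDerivAt_of_tendsto hasDerivAt_fhypPrimitive integrable_fhyp
      tendsto_fhypPrimitive_atBot tendsto_fhypPrimitive_atTop]
    norm_num
  · rw [integral_Iic_of_hasDerivAt_of_tendsto' (fun x _ => hasDerivAt_fhypPrimitive x)
      integrable_fhyp.integrableOn tendsto_fhypPrimitive_atBot, fhypPrimitive_eq ht]
    ring
end
end

section
/- For every integer d ≥ 2, the function f is nonnegative and ∫_{ℝ^d} f(x) dx = 1, i.e. f is a probability density on ℝ^d. -/
noncomputable section
open MeasureTheory Real

/-- The density on `ℝ^d` of the self-concordant perturbation for the Euclidean ball: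
`f(x) = (Γ(d+1/2)/(2 π^{d/2} Γ((d+1)/2))) ∫₀¹ t^{(d−1)/2} (1 + t‖x‖²)^{−d−1/2} dt`. -/
def fball (d : ℕ) (x : E d) : ℝ :=
  (Real.Gamma ((d : ℝ) + 1/2) / (2 * Real.pi ^ ((d : ℝ)/2) * Real.Gamma (((d : ℝ) + 1)/2))) *
    ∫ t in (0:ℝ)..1, t ^ (((d : ℝ) - 1)/2) * (1 + t * ‖x‖^2) ^ (-(d : ℝ) - 1/2)

lemma lintegral_rpow_mul_exp_neg_mul_Ioi {a r : ℝ} (ha : 0 < a) (hr : 0 < r) :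
    ∫⁻ u in Set.Ioi (0 : ℝ), ENNReal.ofReal (u ^ (a - 1) * rexp (-(r * u))) =
      ENNReal.ofReal ((1 / r) ^ a * Real.Gamma a) := by
  have hval := Real.integral_rpow_mul_exp_neg_mul_Ioi ha hr
  rw [← hval, ofReal_integral_eq_lintegral_ofReal]
  · apply Integrable.of_integral_ne_zero
    rw [hval]
    have := Real.Gamma_pos_of_pos ha
    positivity
  · filter_upwards [ae_restrict_mem measurableSet_Ioi] with u hu
    have : (0 : ℝ) < u := hu
    positivity

lemma lintegral_exp_neg_mul_sq_norm (d : ℕ) {b : ℝ} (hb : 0 < b) :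
    ∫⁻ x : E d, ENNReal.ofReal (rexp (-b * ‖x‖ ^ 2)) =
      ENNReal.ofReal ((π / b) ^ ((d : ℝ) / 2)) := by
  have hval := GaussianFourier.integral_rexp_neg_mul_sq_norm (V := E d) hb
  rw [finrank_euclideanSpace_fin] at hval
  rw [← hval, ofReal_integral_eq_lintegral_ofReal]
  · apply Integrable.of_integral_ne_zero
    rw [hval]
    positivity
  · exact Filter.Eventually.of_forall fun x => (exp_pos _).le

/-- The `d`-dimensional Student-type integral, obtained by writing `(1 + t‖x‖²) ^ (-s)` as a
mixture of Gaussians. -/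
lemma lintegral_one_add_mul_sq_norm_rpow_neg (d : ℕ) {s t : ℝ} (hs : (d : ℝ) / 2 < s)
    (ht : 0 < t) :
    ∫⁻ x : E d, ENNReal.ofReal ((1 + t * ‖x‖ ^ 2) ^ (-s)) =
      ENNReal.ofReal ((π / t) ^ ((d : ℝ) / 2) * Real.Gamma (s - d / 2) / Real.Gamma s) := by
  have hs0 : 0 < s := lt_of_le_of_lt (by positivity) hs
  have hG := Real.Gamma_pos_of_pos hs0
  have hmix (x : E d) : ENNReal.ofReal ((1 + t * ‖x‖ ^ 2) ^ (-s)) =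
      ENNReal.ofReal (1 / Real.Gamma s) * ∫⁻ u in Set.Ioi (0 : ℝ),
        ENNReal.ofReal (u ^ (s - 1) * rexp (-((1 + t * ‖x‖ ^ 2) * u))) := by
    have hc : 0 < 1 + t * ‖x‖ ^ 2 := by positivity
    rw [lintegral_rpow_mul_exp_neg_mul_Ioi hs0 hc, ← ENNReal.ofReal_mul (by positivity),
      one_div (1 + _), Real.inv_rpow hc.le, Real.rpow_neg hc.le]
    congr 1
    field_simp
  simp_rw [hmix]
  rw [lintegral_const_mul' _ _ ENNReal.ofReal_ne_top, lintegral_lintegral_swap (by fun_prop)]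
  have hinner : ∀ u ∈ Set.Ioi (0 : ℝ),
      ∫⁻ x : E d, ENNReal.ofReal (u ^ (s - 1) * rexp (-((1 + t * ‖x‖ ^ 2) * u))) =
        ENNReal.ofReal ((π / t) ^ ((d : ℝ) / 2)) *
          ENNReal.ofReal (u ^ (s - d / 2 - 1) * rexp (-(1 * u))) := by
    intro u hu
    have hu : 0 < u := hu
    have hsplit (x : E d) : ENNReal.ofReal (u ^ (s - 1) * rexp (-((1 + t * ‖x‖ ^ 2) * u))) =
        ENNReal.ofReal (u ^ (s - 1) * rexp (-u)) *
          ENNReal.ofReal (rexp (-(t * u) * ‖x‖ ^ 2)) := by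
      rw [← ENNReal.ofReal_mul (by positivity), mul_assoc, ← Real.exp_add]
      congr 3
      ring
    simp_rw [hsplit]
    rw [lintegral_const_mul' _ _ ENNReal.ofReal_ne_top,
      lintegral_exp_neg_mul_sq_norm d (by positivity : 0 < t * u),
      ← ENNReal.ofReal_mul (by positivity), ← ENNReal.ofReal_mul (by positivity)]
    congr 1
    rw [show s - d / 2 - 1 = (s - 1) - d / 2 by ring, Real.rpow_sub hu (s - 1), ← div_div,
      Real.div_rpow (by positivity) hu.le, one_mul]
    ring
  rw [setLIntegral_congr_fun measurableSet_Ioi hinner,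
    lintegral_const_mul' _ _ ENNReal.ofReal_ne_top,
    lintegral_rpow_mul_exp_neg_mul_Ioi (by linarith) one_pos,
    ← ENNReal.ofReal_mul (by positivity), ← ENNReal.ofReal_mul (by positivity)]
  congr 1
  simp only [div_one, Real.one_rpow]
  ring

lemma lintegral_rpow_neg_half_Ioc :
    ∫⁻ t in Set.Ioc (0 : ℝ) 1, ENNReal.ofReal (t ^ (-(1 / 2) : ℝ)) = ENNReal.ofReal 2 := by
  have hint : IntervalIntegrable (fun t : ℝ => t ^ (-(1 / 2) : ℝ)) volume 0 1 :=
    intervalIntegral.intervalIntegrable_rpow' (by norm_num)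
  rw [← ofReal_integral_eq_lintegral_ofReal
    ((intervalIntegrable_iff_integrableOn_Ioc_of_le zero_le_one).1 hint),
    ← intervalIntegral.integral_of_le zero_le_one, integral_rpow (by norm_num)]
  · norm_num
  · filter_upwards [ae_restrict_mem measurableSet_Ioc] with t ht
    exact Real.rpow_nonneg ht.1.le _

/-- The mixing integral in the definition of `fball`, as a lower Lebesgue integral. -/
lemma ofReal_intervalIntegral_rpow_mul {d : ℕ} (hd : 1 ≤ d) (x : E d) :
    ENNReal.ofReal (∫ t in (0 : ℝ)..1,
        t ^ (((d : ℝ) - 1) / 2) * (1 + t * ‖x‖ ^ 2) ^ (-(d : ℝ) - 1 / 2)) =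
      ∫⁻ t in Set.Ioc (0 : ℝ) 1, ENNReal.ofReal
        (t ^ (((d : ℝ) - 1) / 2) * (1 + t * ‖x‖ ^ 2) ^ (-(d : ℝ) - 1 / 2)) := by
  have hd' : (1 : ℝ) ≤ d := by exact_mod_cast hd
  rw [intervalIntegral.integral_of_le zero_le_one, ofReal_integral_eq_lintegral_ofReal]
  · refine (ContinuousOn.integrableOn_Icc ?_).mono_set Set.Ioc_subset_Icc_self
    refine ContinuousOn.mul ?_ ?_
    · exact (Real.continuous_rpow_const (by linarith)).continuousOn
    · refine ContinuousOn.rpow_const (by fun_prop) fun t ht => Or.inl ?_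
      have := ht.1
      positivity
  · filter_upwards [ae_restrict_mem measurableSet_Ioc] with t ht
    have := ht.1
    positivity

lemma fball_nonneg (d : ℕ) (x : E d) : 0 ≤ fball d x := by
  have h1 : 0 < Real.Gamma ((d : ℝ) + 1 / 2) := Real.Gamma_pos_of_pos (by positivity)
  have h2 : 0 < Real.Gamma (((d : ℝ) + 1) / 2) := Real.Gamma_pos_of_pos (by positivity)
  refine mul_nonneg (by positivity) (intervalIntegral.integral_nonneg zero_le_one fun t ht => ?_)
  have := ht.1
  positivity

lemma stronglyMeasurable_fball (d : ℕ) : StronglyMeasurable (fball d) := by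
  unfold fball
  simp_rw [intervalIntegral.integral_of_le zero_le_one]
  refine StronglyMeasurable.const_mul ?_ _
  refine StronglyMeasurable.integral_prod_right (f := fun (x : E d) (t : ℝ) =>
    t ^ (((d : ℝ) - 1) / 2) * (1 + t * ‖x‖ ^ 2) ^ (-(d : ℝ) - 1 / 2)) ?_
  exact Measurable.stronglyMeasurable (by fun_prop)

lemma lintegral_fball {d : ℕ} (hd : 1 ≤ d) : ∫⁻ x : E d, ENNReal.ofReal (fball d x) = 1 := by
  have h1 : 0 < Real.Gamma ((d : ℝ) + 1 / 2) := Real.Gamma_pos_of_pos (by positivity)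
  have h2 : 0 < Real.Gamma (((d : ℝ) + 1) / 2) := Real.Gamma_pos_of_pos (by positivity)
  have hexp : ((d : ℝ) + 1 / 2) - d / 2 = (d + 1) / 2 := by ring
  have hinner : ∀ t ∈ Set.Ioc (0 : ℝ) 1,
      ∫⁻ x : E d, ENNReal.ofReal
        (t ^ (((d : ℝ) - 1) / 2) * (1 + t * ‖x‖ ^ 2) ^ (-(d : ℝ) - 1 / 2)) =
      ENNReal.ofReal (π ^ ((d : ℝ) / 2) * Real.Gamma ((d + 1) / 2) / Real.Gamma (d + 1 / 2)) *
        ENNReal.ofReal (t ^ (-(1 / 2) : ℝ)) := by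
    intro t ht
    have ht : 0 < t := ht.1
    have hneg : -(d : ℝ) - 1 / 2 = -(d + 1 / 2) := by ring
    simp_rw [hneg, ENNReal.ofReal_mul (Real.rpow_nonneg ht.le (((d : ℝ) - 1) / 2))]
    rw [lintegral_const_mul' _ _ ENNReal.ofReal_ne_top,
      lintegral_one_add_mul_sq_norm_rpow_neg d (by linarith [d.cast_nonneg (α := ℝ)]) ht, hexp,
      ← ENNReal.ofReal_mul (by positivity), ← ENNReal.ofReal_mul (by positivity)]
    congr 1
    rw [show (-(1 / 2) : ℝ) = ((d : ℝ) - 1) / 2 - d / 2 by ring, Real.rpow_sub ht,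
      Real.div_rpow (by positivity) ht.le]
    ring
  unfold fball
  simp_rw [ENNReal.ofReal_mul (show 0 ≤ Real.Gamma ((d : ℝ) + 1 / 2) /
    (2 * π ^ ((d : ℝ) / 2) * Real.Gamma (((d : ℝ) + 1) / 2)) by positivity),
    ofReal_intervalIntegral_rpow_mul hd]
  rw [lintegral_const_mul' _ _ ENNReal.ofReal_ne_top, lintegral_lintegral_swap (by fun_prop),
    setLIntegral_congr_fun measurableSet_Ioc hinner,
    lintegral_const_mul' _ _ ENNReal.ofReal_ne_top, lintegral_rpow_neg_half_Ioc,
    ← ENNReal.ofReal_mul (by positivity), ← ENNReal.ofReal_mul (by positivity),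
    ← ENNReal.ofReal_one]
  congr 1
  field_simp

/-- For every `d ≥ 2`, `fball d` is nonnegative and integrates to `1` over
`ℝ^d` (w.r.t. the Lebesgue measure), i.e. it is a probability density on `ℝ^d`. -/
theorem statement13 {d : ℕ} (hd : 2 ≤ d) :
    (∀ x : E d, 0 ≤ fball d x) ∧ (∫ x : E d, fball d x) = 1 := by
  refine ⟨fball_nonneg d, ?_⟩
  rw [integral_eq_lintegral_of_nonneg_ae (Filter.Eventually.of_forall (fball_nonneg d))
    (stronglyMeasurable_fball d).aestronglyMeasurable, lintegral_fball (by omega),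
    ENNReal.toReal_one]
end
end

section
/- For every integer d ≥ 2 and every real x ≥ 0, ∫₀^∞ ∫₀^π √(x² + r² + 2 r x cos φ) · sin^{d−2}(φ) · r^{d−1} · (1+r²)^{−d−1/2} dφ dr = (√π / 2) · ( Γ((d−1)/2) Γ((d+1)/2) / Γ(d+1/2) ) · √(1+x²). -/
noncomputable section
open MeasureTheory Real

open Set UpperHalfPlane in
theorem UpperHalfPlane.integral_eq_setIntegral_complex (F : ℂ → ℝ) :
    ∫ τ : ℍ, F τ = ∫ z in {z : ℂ | 0 < z.im}, F z / z.im ^ 2 := by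
  have hmeas : Measurable fun τ : ℍ ↦ ((1 / NNReal.mk τ.im τ.im_pos.le : NNReal) ^ 2) := by
    have : Measurable fun τ : ℍ ↦ NNReal.mk τ.im τ.im_pos.le :=
      (Complex.measurable_im.comp measurable_coe).subtype_mk
    exact (this.const_div 1).pow_const 2
  have hmp : MeasurePreserving UpperHalfPlane.coe (volume.comap UpperHalfPlane.coe)
      (volume.restrict {z : ℂ | 0 < z.im}) := by
    refine ⟨measurable_coe, ?_⟩
    rw [measurableEmbedding_coe.map_comap, range_coe]
  rw [volume_def, integral_withDensity_eq_integral_smul hmeas,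
    ← hmp.integral_comp measurableEmbedding_coe]
  refine integral_congr_ae (Filter.Eventually.of_forall fun τ ↦ ?_)
  simp only [NNReal.smul_def, smul_eq_mul, NNReal.coe_pow, NNReal.coe_div, NNReal.coe_one,
    NNReal.coe_mk, coe_im]
  ring

open Set UpperHalfPlane in
theorem UpperHalfPlane.integral_eq_setIntegral_polar (F : ℂ → ℝ) :
    ∫ τ : ℍ, F τ = ∫ p in Ioi (0 : ℝ) ×ˢ Ioo (0 : ℝ) π,
      p.1 * (F (p.1 * (Real.cos p.2 + Real.sin p.2 * Complex.I)) / (p.1 * Real.sin p.2) ^ 2) := by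
  have hm : MeasurableSet {z : ℂ | 0 < z.im} := measurableSet_lt measurable_const
    Complex.measurable_im
  have hs : MeasurableSet (Ioi (0 : ℝ) ×ˢ Ioo (0 : ℝ) π) := measurableSet_Ioi.prod measurableSet_Ioo
  rw [integral_eq_setIntegral_complex, ← integral_indicator hm,
    ← Complex.integral_comp_polarCoord_symm, ← integral_indicator hs,
    ← integral_indicator polarCoord.open_target.measurableSet]
  congr 1
  ext ⟨r, φ⟩
  simp only [indicator_apply, Complex.polarCoord_symm_apply, smul_eq_mul, polarCoord_target,
    mem_prod, mem_Ioi, mem_Ioo, mem_ofPred_eq]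
  have him : ((r : ℂ) * (Real.cos φ + Real.sin φ * Complex.I)).im = r * Real.sin φ := by
    simp [-Complex.ofReal_cos, -Complex.ofReal_sin]
  rw [him]
  by_cases hr : 0 < r
  swap
  · simp [hr]
  by_cases hφ : 0 < φ ∧ φ < π
  · have : 0 < r * Real.sin φ := mul_pos hr (Real.sin_pos_of_pos_of_lt_pi hφ.1 hφ.2)
    rw [if_pos ⟨hr, by linarith [pi_pos], hφ.2⟩, if_pos this, if_pos ⟨hr, hφ⟩]
  · rw [if_neg (by tauto : ¬(0 < r ∧ 0 < φ ∧ φ < π))]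
    split_ifs with h1 h2
    · exfalso
      have hle : φ ≤ 0 := by
        by_contra! h
        exact hφ ⟨h, h1.2.2⟩
      have := Real.sin_nonpos_of_nonpos_of_neg_pi_le hle h1.2.1.le
      nlinarith
    · simp
    · rfl

/-- The integrand of the radial identity as a density with respect to the invariant measure of the
upper half-plane. -/
def halfPlaneKernel (d : ℕ) (x : ℝ) (z : ℂ) : ℝ :=
  ‖z + x‖ * z.im ^ d * (1 + Complex.normSq z) ^ (-(d : ℝ) - 1 / 2)

open UpperHalfPlane in
theorem integral_halfPlaneKernel (d : ℕ) (x : ℝ) :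
    ∫ τ : ℍ, halfPlaneKernel d x τ = √(1 + x ^ 2) * ∫ τ : ℍ, halfPlaneKernel d 0 τ := by
  have hpos : 0 < 1 + x ^ 2 := by positivity
  have hdet : Matrix.det !![1, -x; x, 1] = 1 + x ^ 2 := by
    rw [Matrix.det_fin_two_of]; ring
  let g : GL (Fin 2) ℝ := Matrix.GeneralLinearGroup.mkOfDetNeZero !![1, -x; x, 1]
    (by rw [hdet]; exact hpos.ne')
  have hg : g.det.val = 1 + x ^ 2 := hdet
  rw [← integral_smul_eq_self (fun τ : ℍ ↦ halfPlaneKernel d x τ) (g := g), ← integral_const_mul]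
  refine integral_congr_ae (Filter.Eventually.of_forall fun τ ↦ ?_)
  have hnum : num g τ = τ - x := by
    simp [num, g, Matrix.GeneralLinearGroup.mkOfDetNeZero, sub_eq_add_neg]
  have hden : denom g τ = x * τ + 1 := by
    simp [denom, g, Matrix.GeneralLinearGroup.mkOfDetNeZero]
  have hD0 : (x * τ + 1 : ℂ) ≠ 0 := hden ▸ denom_ne_zero g τ
  have hsm : ((g • τ : ℍ) : ℂ) = (τ - x) / (x * τ + 1) := by
    rw [coe_smul_of_det_pos (by rw [hg]; exact hpos), hnum, hden]
  have him : ((g • τ : ℍ) : ℂ).im = (1 + x ^ 2) * (τ : ℂ).im / Complex.normSq (x * τ + 1) := by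
    rw [coe_im, im_smul_eq_div_normSq, hg, hden, abs_of_pos hpos, coe_im]
  have hadd : ‖((g • τ : ℍ) : ℂ) + x‖ = (1 + x ^ 2) * ‖(τ : ℂ)‖ / ‖(x * τ + 1 : ℂ)‖ := by
    have : ((g • τ : ℍ) : ℂ) + x = ((1 + x ^ 2 : ℝ) : ℂ) * τ / (x * τ + 1) := by
      rw [hsm, div_add' _ _ _ hD0]
      push_cast
      ring
    rw [this, norm_div, norm_mul, Complex.norm_real, Real.norm_of_nonneg hpos.le]
  have hN : 0 < Complex.normSq (x * τ + 1) := Complex.normSq_pos.mpr hD0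
  have hsq : 1 + Complex.normSq ((g • τ : ℍ) : ℂ) =
      (1 + x ^ 2) * (1 + Complex.normSq τ) / Complex.normSq (x * τ + 1) := by
    rw [hsm, Complex.normSq_div, eq_div_iff hN.ne', add_mul, div_mul_cancel₀ _ hN.ne']
    simp [Complex.normSq_apply]
    ring
  simp only [halfPlaneKernel]
  rw [him, hadd, hsq]
  set N := Complex.normSq (x * τ + 1) with hNdef
  have hnorm : ‖(x * τ + 1 : ℂ)‖ = N ^ (1 / 2 : ℝ) := by
    rw [← Real.sqrt_eq_rpow, hNdef, Complex.normSq_eq_norm_sq, Real.sqrt_sq (norm_nonneg _)]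
  have hq : 0 < 1 + Complex.normSq (τ : ℂ) := by
    linarith [Complex.normSq_nonneg (τ : ℂ)]
  rw [hnorm, Real.div_rpow (by positivity) hN.le, Real.mul_rpow hpos.le hq.le, Real.sqrt_eq_rpow]
  have hexp_zero (y : ℝ) (hy : 0 < y) : y ^ (1 / 2 : ℝ) * (y ^ d * y ^ (-(d : ℝ) - 1 / 2)) = 1 := by
    rw [← Real.rpow_natCast, ← Real.rpow_add hy, ← Real.rpow_add hy, ← Real.rpow_zero y]
    congr 1
    ring
  have hexp_half (y : ℝ) (hy : 0 < y) :
      y * (y ^ d * y ^ (-(d : ℝ) - 1 / 2)) = y ^ (1 / 2 : ℝ) := by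
    nth_rw 1 [← Real.rpow_one y]
    rw [← Real.rpow_natCast, ← Real.rpow_add hy, ← Real.rpow_add hy]
    congr 1
    ring
  rw [← hexp_half _ hpos]
  simp only [Complex.ofReal_zero, add_zero, mul_pow, div_pow]
  rw [eq_comm, div_mul_div_comm, div_mul_div_comm, mul_assoc (N ^ _), hexp_zero N hN, div_one]
  ring

theorem integral_sin_pow_eq_Gamma (n : ℕ) :
    ∫ φ in (0 : ℝ)..π, Real.sin φ ^ n =
      √π * Real.Gamma (((n : ℝ) + 1) / 2) / Real.Gamma ((n : ℝ) / 2 + 1) := by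
  induction n using Nat.twoStepInduction with
  | zero =>
    simp [Real.Gamma_one_half_eq, -one_div, Real.mul_self_sqrt pi_pos.le]
  | one =>
    have : Real.Gamma (1 / 2 + 1) = 1 / 2 * √π := by
      rw [Real.Gamma_add_one (by norm_num), Real.Gamma_one_half_eq]
    have h : √π ≠ 0 := by positivity
    simp only [pow_one, integral_sin, Nat.cast_one, this]
    norm_num
    field_simp
  | more n ih _ =>
    rw [integral_sin_pow, ih]
    have h1 : (((n + 2 : ℕ) : ℝ) + 1) / 2 = ((n : ℝ) + 1) / 2 + 1 := by push_cast; ring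
    have h2 : ((n + 2 : ℕ) : ℝ) / 2 + 1 = ((n : ℝ) / 2 + 1) + 1 := by push_cast; ring
    have hG : Real.Gamma ((n : ℝ) / 2 + 1) ≠ 0 := (Real.Gamma_pos_of_pos (by positivity)).ne'
    rw [h1, h2, Real.Gamma_add_one (s := ((n : ℝ) + 1) / 2) (by positivity),
      Real.Gamma_add_one (s := (n : ℝ) / 2 + 1) (by positivity)]
    generalize Real.Gamma ((n : ℝ) / 2 + 1) = G at hG
    generalize Real.Gamma (((n : ℝ) + 1) / 2) = H
    simp
    field_simp

open Set in
/-- The Euler beta integral over `(0, 1)` in the variable `t = r² / (1 + r²)`. -/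
theorem integral_Ioi_pow_mul_one_add_sq_rpow {d : ℕ} (hd : 1 ≤ d) :
    ∫ r in Ioi (0 : ℝ), r ^ d * (1 + r ^ 2) ^ (-(d : ℝ) - 1 / 2) =
      Real.Gamma (((d : ℝ) + 1) / 2) * Real.Gamma ((d : ℝ) / 2) / Real.Gamma ((d : ℝ) + 1 / 2) / 2
      := by
  have hd0 : (0 : ℝ) < d := by exact_mod_cast hd
  set u : ℝ := ((d : ℝ) + 1) / 2 with hu
  set v : ℝ := (d : ℝ) / 2 with hv
  have hbeta : ∫ t in Ioo (0 : ℝ) 1, t ^ (u - 1) * (1 - t) ^ (v - 1) =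
      Real.Gamma u * Real.Gamma v / Real.Gamma (u + v) := by
    have h := ProbabilityTheory.beta_eq_betaIntegralReal u v (by positivity) (by positivity)
    rw [ProbabilityTheory.beta] at h
    rw [h, Complex.betaIntegral, intervalIntegral.integral_of_le zero_le_one,
      integral_Ioc_eq_integral_Ioo]
    have : ∫ t in Ioo (0 : ℝ) 1, (t : ℂ) ^ ((u : ℂ) - 1) * (1 - (t : ℂ)) ^ ((v : ℂ) - 1) =
        ∫ t in Ioo (0 : ℝ) 1, ((t ^ (u - 1) * (1 - t) ^ (v - 1) : ℝ) : ℂ) := by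
      refine setIntegral_congr_fun measurableSet_Ioo fun t ht ↦ ?_
      rw [Complex.ofReal_mul, Complex.ofReal_cpow ht.1.le,
        Complex.ofReal_cpow (by linarith [ht.2])]
      push_cast
      rfl
    rw [this, integral_complex_ofReal, Complex.ofReal_re]
  have himage : (fun r : ℝ ↦ r ^ 2 / (1 + r ^ 2)) '' Ioi 0 = Ioo 0 1 := by
    ext t
    constructor
    · rintro ⟨r, hr, rfl⟩
      have : (0 : ℝ) < r := hr
      refine ⟨by positivity, ?_⟩
      rw [div_lt_one (by positivity)]
      linarith
    · rintro ⟨h0, h1⟩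
      have h2 : 0 < 1 - t := by linarith
      refine ⟨√(t / (1 - t)), Real.sqrt_pos.mpr (by positivity), ?_⟩
      simp only
      rw [Real.sq_sqrt (by positivity)]
      field_simp
      ring
  have hinj : InjOn (fun r : ℝ ↦ r ^ 2 / (1 + r ^ 2)) (Ioi 0) := by
    intro a ha b hb hab
    have ha' : (0 : ℝ) < a := ha
    have hb' : (0 : ℝ) < b := hb
    simp only at hab
    rw [div_eq_div_iff (by positivity) (by positivity)] at hab
    exact (pow_left_inj₀ ha'.le hb'.le two_ne_zero).mp (by linarith)
  have hderiv : ∀ r ∈ Ioi (0 : ℝ), HasDerivWithinAt (fun r : ℝ ↦ r ^ 2 / (1 + r ^ 2))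
      (2 * r / (1 + r ^ 2) ^ 2) (Ioi 0) r := by
    intro r _
    have h1 : HasDerivAt (fun r : ℝ ↦ r ^ 2) (2 * r) r := by simpa using hasDerivAt_pow 2 r
    have h2 := h1.div (h1.const_add 1) (by positivity)
    refine (h2.congr_deriv ?_).hasDerivWithinAt
    ring
  have hcov := integral_image_eq_integral_abs_deriv_smul measurableSet_Ioi hderiv hinj
    (fun t ↦ t ^ (u - 1) * (1 - t) ^ (v - 1))
  rw [himage, hbeta] at hcov
  have huv : u + v = (d : ℝ) + 1 / 2 := by rw [hu, hv]; ring
  rw [← huv, hcov, ← integral_div]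
  refine setIntegral_congr_fun measurableSet_Ioi fun r hr ↦ ?_
  have hr' : (0 : ℝ) < r := hr
  have hq : 0 < 1 + r ^ 2 := by positivity
  have h1 : 1 - r ^ 2 / (1 + r ^ 2) = (1 + r ^ 2)⁻¹ := by field_simp; ring
  have h2 : (r ^ 2) ^ (u - 1) * r = r ^ d := by
    rw [← Real.rpow_natCast r 2, ← Real.rpow_mul hr'.le, ← Real.rpow_natCast]
    nth_rw 2 [← Real.rpow_one r]
    rw [← Real.rpow_add hr']
    congr 1
    rw [hu]; push_cast; ring
  have h3 (y : ℝ) (hy : 0 < y) :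
      y ^ (-(u - 1)) * y ^ (-(v - 1)) * (y ^ 2)⁻¹ = y ^ (-(d : ℝ) - 1 / 2) := by
    rw [← Real.rpow_natCast _ 2, ← Real.rpow_neg hy.le, ← Real.rpow_add hy, ← Real.rpow_add hy]
    congr 1
    rw [hu, hv]; push_cast; ring
  simp only [smul_eq_mul]
  rw [h1, abs_of_pos (by positivity), Real.div_rpow (by positivity) hq.le,
    Real.inv_rpow hq.le, ← Real.rpow_neg hq.le, ← h2, ← h3 _ hq, div_eq_mul_inv _ ((1 + r ^ 2) ^ (u - 1)),
    ← Real.rpow_neg hq.le]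
  ring

theorem integrableOn_radial_integrand {d : ℕ} (hd : 2 ≤ d) {x : ℝ} (hx : 0 ≤ x) :
    IntegrableOn (fun p : ℝ × ℝ ↦ √(x ^ 2 + p.1 ^ 2 + 2 * p.1 * x * Real.cos p.2) *
      Real.sin p.2 ^ (d - 2) * p.1 ^ (d - 1) * (1 + p.1 ^ 2) ^ (-(d : ℝ) - 1 / 2))
      (Set.Ioi (0 : ℝ) ×ˢ Set.Ioo (0 : ℝ) π) (volume.prod volume) := by
  rw [IntegrableOn, ← Measure.prod_restrict]
  have hdom : Integrable (fun p : ℝ × ℝ ↦ ((1 + x) * (1 + p.1 ^ 2)⁻¹) * (1 : ℝ))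
      ((volume.restrict (Set.Ioi (0 : ℝ))).prod (volume.restrict (Set.Ioo (0 : ℝ) π))) :=
    (integrable_inv_one_add_sq.const_mul (1 + x)).integrableOn.mul_prod
      (integrableOn_const (by simp))
  refine hdom.mono' ?_ ?_
  · refine Measurable.aestronglyMeasurable ?_
    fun_prop
  · rw [Measure.prod_restrict]
    filter_upwards [ae_restrict_mem (measurableSet_Ioi.prod measurableSet_Ioo)] with ⟨r, φ⟩ hp
    have hr : 0 < r := hp.1
    have hs : 0 ≤ Real.sin φ := (Real.sin_pos_of_pos_of_lt_pi hp.2.1 hp.2.2).le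
    have hq : 0 < 1 + r ^ 2 := by positivity
    have hq1 : 1 ≤ 1 + r ^ 2 := by nlinarith
    simp only
    rw [Real.norm_of_nonneg (by positivity), mul_one]
    have h1 : √(x ^ 2 + r ^ 2 + 2 * r * x * Real.cos φ) ≤ (1 + x) * (1 + r ^ 2) ^ (1 / 2 : ℝ) := by
      rw [← Real.sqrt_eq_rpow]
      have hle : 1 ≤ √(1 + r ^ 2) := Real.one_le_sqrt.mpr hq1
      have hle2 : r ≤ √(1 + r ^ 2) := Real.le_sqrt_of_sq_le (by linarith)
      calc √(x ^ 2 + r ^ 2 + 2 * r * x * Real.cos φ) ≤ √((r + x) ^ 2) := by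
            apply Real.sqrt_le_sqrt
            have : 2 * r * x * Real.cos φ ≤ 2 * r * x * 1 :=
              mul_le_mul_of_nonneg_left (Real.cos_le_one φ) (by positivity)
            linarith
        _ = r + x := Real.sqrt_sq (by positivity)
        _ ≤ (1 + x) * √(1 + r ^ 2) := by nlinarith
    have h2 : Real.sin φ ^ (d - 2) ≤ 1 := pow_le_one₀ hs (Real.sin_le_one φ)
    have h3 : r ^ (d - 1) ≤ (1 + r ^ 2) ^ (((d : ℝ) - 1) / 2) := by
      have hle2 : r ≤ (1 + r ^ 2) ^ (1 / 2 : ℝ) := by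
        rw [← Real.sqrt_eq_rpow]
        exact Real.le_sqrt_of_sq_le (by linarith)
      calc r ^ (d - 1) ≤ ((1 + r ^ 2) ^ (1 / 2 : ℝ)) ^ (d - 1) := pow_le_pow_left₀ hr.le hle2 _
        _ = _ := by
          rw [← Real.rpow_natCast, ← Real.rpow_mul hq.le, Nat.cast_sub (by omega)]
          congr 1
          push_cast; ring
    calc √(x ^ 2 + r ^ 2 + 2 * r * x * Real.cos φ) * Real.sin φ ^ (d - 2) * r ^ (d - 1) *
          (1 + r ^ 2) ^ (-(d : ℝ) - 1 / 2)
        ≤ (1 + x) * (1 + r ^ 2) ^ (1 / 2 : ℝ) * 1 * (1 + r ^ 2) ^ (((d : ℝ) - 1) / 2) *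
          (1 + r ^ 2) ^ (-(d : ℝ) - 1 / 2) := by gcongr
      _ = (1 + x) * (1 + r ^ 2) ^ (-((d : ℝ) + 1) / 2) := by
          rw [mul_one, mul_assoc, mul_assoc, ← Real.rpow_add hq, ← Real.rpow_add hq]
          congr 2
          ring
      _ ≤ (1 + x) * (1 + r ^ 2)⁻¹ := by
          rw [← Real.rpow_neg_one]
          have : (2 : ℝ) ≤ d := by exact_mod_cast hd
          gcongr
          linarith

/-- The radial integral is the integral of `halfPlaneKernel` in polar coordinates. -/
theorem radial_integral_eq_integral_halfPlaneKernel {d : ℕ} (hd : 2 ≤ d) {x : ℝ} (hx : 0 ≤ x) :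
    (∫ r in Set.Ioi (0 : ℝ), ∫ φ in (0 : ℝ)..π,
        √(x ^ 2 + r ^ 2 + 2 * r * x * Real.cos φ) * Real.sin φ ^ (d - 2) *
          r ^ (d - 1) * (1 + r ^ 2) ^ (-(d : ℝ) - 1 / 2)) =
      ∫ τ : UpperHalfPlane, halfPlaneKernel d x τ := by
  simp_rw [intervalIntegral.integral_of_le pi_pos.le, integral_Ioc_eq_integral_Ioo]
  rw [← setIntegral_prod _ (integrableOn_radial_integrand hd hx),
    UpperHalfPlane.integral_eq_setIntegral_polar]
  refine setIntegral_congr_fun (measurableSet_Ioi.prod measurableSet_Ioo) ?_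
  rintro ⟨r, φ⟩ ⟨hr, hφ⟩
  simp only at hr hφ ⊢
  have hr' : (0 : ℝ) < r := hr
  have hs : 0 < Real.sin φ := Real.sin_pos_of_pos_of_lt_pi hφ.1 hφ.2
  have hre : ((r : ℂ) * (Real.cos φ + Real.sin φ * Complex.I)).re = r * Real.cos φ := by
    simp [-Complex.ofReal_cos, -Complex.ofReal_sin]
  have him : ((r : ℂ) * (Real.cos φ + Real.sin φ * Complex.I)).im = r * Real.sin φ := by
    simp [-Complex.ofReal_cos, -Complex.ofReal_sin]
  have hcs := Real.sin_sq_add_cos_sq φ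
  have hN : Complex.normSq ((r : ℂ) * (Real.cos φ + Real.sin φ * Complex.I)) = r ^ 2 := by
    rw [Complex.normSq_apply, hre, him]
    linear_combination r ^ 2 * hcs
  have hA : ‖(r : ℂ) * (Real.cos φ + Real.sin φ * Complex.I) + x‖ =
      √(x ^ 2 + r ^ 2 + 2 * r * x * Real.cos φ) := by
    rw [Complex.norm_def, Complex.normSq_apply, Complex.add_re, Complex.add_im, hre, him,
      Complex.ofReal_re, Complex.ofReal_im]
    congr 1
    linear_combination r ^ 2 * hcs
  rw [halfPlaneKernel, hA, him, hN]
  obtain ⟨n, rfl⟩ := Nat.exists_eq_add_of_le' hd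
  simp only [Nat.add_sub_cancel, show n + 2 - 1 = n + 1 by omega]
  field_simp
  ring

/-- the key radial integral identity on the ball.
For every integer `d ≥ 2` and real `x ≥ 0`,
`∫₀^∞ ∫₀^π √(x² + r² + 2rx cos φ) sin^{d−2}φ · r^{d−1} (1+r²)^{−d−1/2} dφ dr
  = (√π/2) (Γ((d−1)/2) Γ((d+1)/2) / Γ(d+1/2)) √(1+x²)`. -/
theorem statement15 {d : ℕ} (hd : 2 ≤ d) (x : ℝ) (hx : 0 ≤ x) :
    (∫ r in Set.Ioi (0:ℝ), ∫ φ in (0:ℝ)..Real.pi,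
        Real.sqrt (x^2 + r^2 + 2*r*x*Real.cos φ) * (Real.sin φ)^(d-2) *
          r^(d-1) * (1 + r^2) ^ (-(d : ℝ) - 1/2)) =
      (Real.sqrt Real.pi / 2) *
        (Real.Gamma (((d : ℝ) - 1)/2) * Real.Gamma (((d : ℝ) + 1)/2) /
          Real.Gamma ((d : ℝ) + 1/2)) * Real.sqrt (1 + x^2) := by
  have hrad : (∫ r in Set.Ioi (0:ℝ), ∫ φ in (0:ℝ)..Real.pi,
      Real.sqrt ((0 : ℝ)^2 + r^2 + 2*r*0*Real.cos φ) * (Real.sin φ)^(d-2) *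
        r^(d-1) * (1 + r^2) ^ (-(d : ℝ) - 1/2)) =
      (∫ φ in (0 : ℝ)..π, Real.sin φ ^ (d - 2)) *
        ∫ r in Set.Ioi (0 : ℝ), r ^ d * (1 + r ^ 2) ^ (-(d : ℝ) - 1 / 2) := by
    rw [← integral_const_mul]
    refine setIntegral_congr_fun measurableSet_Ioi fun r hr ↦ ?_
    have hr' : (0 : ℝ) < r := hr
    simp only [ne_eq, OfNat.ofNat_ne_zero, not_false_eq_true, zero_pow, zero_add, mul_zero,
      zero_mul, add_zero, Real.sqrt_sq hr'.le]
    rw [intervalIntegral.integral_mul_const, intervalIntegral.integral_mul_const,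
      intervalIntegral.integral_const_mul]
    obtain ⟨n, rfl⟩ := Nat.exists_eq_add_of_le' hd
    simp only [Nat.add_sub_cancel, show n + 2 - 1 = n + 1 by omega]
    ring
  rw [radial_integral_eq_integral_halfPlaneKernel hd hx, integral_halfPlaneKernel,
    ← radial_integral_eq_integral_halfPlaneKernel hd le_rfl, hrad, integral_sin_pow_eq_Gamma,
    integral_Ioi_pow_mul_one_add_sq_rpow (by omega), Nat.cast_sub hd]
  have h1 : ((d : ℝ) - (2 : ℕ) + 1) / 2 = ((d : ℝ) - 1) / 2 := by push_cast; ring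
  have h2 : ((d : ℝ) - (2 : ℕ)) / 2 + 1 = (d : ℝ) / 2 := by push_cast; ring
  have hG : Real.Gamma ((d : ℝ) / 2) ≠ 0 :=
    (Real.Gamma_pos_of_pos (by have : 0 < d := by omega
                               positivity)).ne'
  rw [h1, h2]
  field_simp
end
end
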